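/- arXiv:0901.2352 — 7 statements merged into one kernel-verified Lean document; each statement's English description precedes it below -/
import Mathlib

section
/- For every integer s ≥ 1 there exists exactly one pair (u, B) with u ∈ ℂ[x] monic of degree s and B ∈ ℂ nonzero, such that there exists a monic polynomial u₂ ∈ ℂ[x] with B + (x+1)·u(x+1)² = x·u₂(x²) in ℂ[x]. -/
open Polynomial

noncomputable section

/-- Coefficients of the Euler operator `X * d/dX`. -/
lemma coeff_X_mul_derivative (p : ℂ[X]) (k : ℕ) :
    (X * derivative p).coeff k = k * p.coeff k := by
  cases k with
  | zero => simp
  | succ k => rw [coeff_X_mul, coeff_derivative]; push_cast; ring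

/-- The Chebyshev differential equation of index `n` has at most one monic solution of
degree `n`. -/
lemma chebyshev_ode_unique {n : ℕ} {F G : ℂ[X]} (hF : F.Monic) (hG : G.Monic)
    (hFn : F.natDegree = n) (hGn : G.natDegree = n)
    (hFode : (n : ℂ[X]) ^ 2 * F =
      X * derivative F + (X ^ 2 - 1) * derivative (derivative F))
    (hGode : (n : ℂ[X]) ^ 2 * G =
      X * derivative G + (X ^ 2 - 1) * derivative (derivative G)) : F = G := by
  by_contra hne
  have hD0 : F - G ≠ 0 := sub_ne_zero.mpr hne
  set D := F - G with hD
  have hlt : D.natDegree < n := by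
    have := degree_sub_lt_left
      (by rw [degree_eq_natDegree hF.ne_zero, degree_eq_natDegree hG.ne_zero, hFn, hGn] : F.degree = G.degree)
      hF.ne_zero (by rw [hF.leadingCoeff, hG.leadingCoeff])
    rw [← hFn]
    exact natDegree_lt_natDegree hD0 this
  have hode : C ((n : ℂ) ^ 2) * D =
      X * derivative (X * derivative D) - derivative (derivative D) := by
    simp only [hD, map_pow, map_natCast, derivative_mul, derivative_X, derivative_sub]
    linear_combination hFode - hGode
  have hcoeff := congrArg (fun p => p.coeff D.natDegree) hode
  have hzero : (derivative (derivative D)).coeff D.natDegree = 0 := by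
    simp [coeff_derivative, coeff_eq_zero_of_natDegree_lt]
  simp only [coeff_C_mul, coeff_sub, coeff_X_mul_derivative, hzero, sub_zero] at hcoeff
  have hlc : D.coeff D.natDegree ≠ 0 := leadingCoeff_ne_zero.mpr hD0
  have hsq : (n : ℂ) ^ 2 = (D.natDegree : ℂ) ^ 2 :=
    mul_right_cancel₀ hlc (by rw [hcoeff]; ring)
  have hnat : n ^ 2 = D.natDegree ^ 2 := by exact_mod_cast hsq
  exact hlt.ne' (Nat.pow_left_injective two_ne_zero hnat)

lemma natDegree_X_add_one_mul_sq {v : ℂ[X]} (hv : v.Monic) :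
    ((X + 1) * v ^ 2).natDegree = 2 * v.natDegree + 1 := by
  have h1 : (X + 1 : ℂ[X]).Monic := monic_X_add_C 1
  have h2 : (X + 1 : ℂ[X]).natDegree = 1 := natDegree_X_add_C 1
  rw [h1.natDegree_mul (hv.pow 2), hv.natDegree_pow, h2]
  ring

lemma natDegree_C_add_mul_sq {v : ℂ[X]} (hv : v.Monic) (B : ℂ) :
    (C B + (X + 1) * v ^ 2).natDegree = 2 * v.natDegree + 1 := by
  rw [natDegree_C_add, natDegree_X_add_one_mul_sq hv]

lemma monic_C_add_mul_sq {v : ℂ[X]} (hv : v.Monic) (B : ℂ) :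
    (C B + (X + 1) * v ^ 2).Monic := by
  have h1 : (X + 1 : ℂ[X]).Monic := monic_X_add_C 1
  refine (h1.mul (hv.pow 2)).add_of_right (degree_C_le.trans_lt ?_)
  rw [← natDegree_pos_iff_degree_pos, natDegree_X_add_one_mul_sq hv]
  omega

/-- An odd polynomial `B + (X + 1) * v ^ 2` with `B ≠ 0` satisfies the Chebyshev differential
equation. -/
lemma chebyshev_ode_of_odd {v F : ℂ[X]} (hv : v.Monic) {B : ℂ} (hB : B ≠ 0)
    (hF : F = C B + (X + 1) * v ^ 2) (hodd : F.comp (-X) = -F) :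
    ((2 * v.natDegree + 1 : ℕ) : ℂ[X]) ^ 2 * F =
      X * derivative F + (X ^ 2 - 1) * derivative (derivative F) := by
  set n := 2 * v.natDegree + 1 with hn
  set w := v.comp (-X) with hw
  have hFw : -F = C B + (1 - X) * w ^ 2 := by
    rw [← hodd, hF, hw]
    simp only [add_comp, mul_comp, pow_comp, C_comp, X_comp, one_comp]
    ring
  have hdeg : F.natDegree = n := by rw [hF, natDegree_C_add_mul_sq hv]
  have hFm : F.Monic := by rw [hF]; exact monic_C_add_mul_sq hv B
  have hlcF' : (derivative F).coeff (2 * v.natDegree) = n := by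
    have h1 : F.coeff (2 * v.natDegree + 1) = 1 := by
      rw [← hn, ← hdeg]; exact hFm.coeff_natDegree
    rw [coeff_derivative, h1, hn]; push_cast; ring
  have hn0 : (n : ℂ) ≠ 0 := by rw [hn]; exact_mod_cast (2 * v.natDegree).succ_ne_zero
  have hF'0 : derivative F ≠ 0 := fun h => hn0 (by rw [← hlcF', h, coeff_zero])
  have hF'deg : (derivative F).natDegree = 2 * v.natDegree := by
    refine le_antisymm ?_ (le_natDegree_of_ne_zero (by rw [hlcF']; exact hn0))
    have := natDegree_derivative_le F
    omega
  have hwdeg : w.natDegree = v.natDegree := by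
    rw [hw, natDegree_comp, natDegree_neg, natDegree_X, mul_one]
  have hwlc : w.leadingCoeff = (-1) ^ v.natDegree := by
    rw [hw, leadingCoeff_comp (by simp), hv.leadingCoeff]; simp
  have hcop : IsCoprime v w := by
    have hCB : C (2 * B)⁻¹ * (2 * C B) = (1 : ℂ[X]) := by
      rw [← C_ofNat, ← C_mul, ← C_mul, inv_mul_cancel₀ (by simpa using hB), C_1]
    refine ⟨-C (2 * B)⁻¹ * (X + 1) * v, -C (2 * B)⁻¹ * (1 - X) * w, ?_⟩
    linear_combination hCB + C (2 * B)⁻¹ * hF + C (2 * B)⁻¹ * hFw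
  have hC2 : (C 2 : ℂ[X]) = 2 := rfl
  have hvd : v ∣ derivative F := by
    refine ⟨v + 2 * (X + 1) * derivative v, ?_⟩
    rw [hF]; simp [derivative_pow, hC2]; ring
  have hwd : w ∣ derivative F := by
    refine ⟨w - 2 * (1 - X) * derivative w, ?_⟩
    have := congrArg derivative hFw
    simp [derivative_pow, hC2] at this
    linear_combination -this
  obtain ⟨q, hq⟩ := hcop.mul_dvd hvd hwd
  have hq0 : q ≠ 0 := by rintro rfl; exact hF'0 (by rw [hq, mul_zero])
  have hvw0 : v * w ≠ 0 := fun h => hF'0 (by rw [hq, h, zero_mul])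
  have hqdeg : q.natDegree = 0 := by
    have h := congrArg natDegree hq
    rw [natDegree_mul hvw0 hq0, natDegree_mul hv.ne_zero (right_ne_zero_of_mul hvw0),
      hF'deg, hwdeg] at h
    omega
  have hqsq : q ^ 2 = (n : ℂ[X]) ^ 2 := by
    have h := congrArg leadingCoeff hq
    rw [leadingCoeff, hF'deg, hlcF', leadingCoeff_mul, leadingCoeff_mul, hv.leadingCoeff, one_mul,
      hwlc] at h
    have hs : (n : ℂ) ^ 2 = q.leadingCoeff ^ 2 := by
      rw [h, mul_pow, ← pow_mul, mul_comm, pow_mul', neg_one_sq, one_pow, mul_one]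
    have hqC : q = C q.leadingCoeff := by
      rw [leadingCoeff, hqdeg]; exact eq_C_of_natDegree_eq_zero hqdeg
    rw [hqC, ← C_pow, ← hs]; simp
  have hpell : (X ^ 2 - 1) * derivative F ^ 2 = (n : ℂ[X]) ^ 2 * (F ^ 2 - C B ^ 2) := by
    have h1 : F - C B = (X + 1) * v ^ 2 := by rw [hF]; ring
    have h2 : F + C B = (X - 1) * w ^ 2 := by linear_combination -hFw
    have h3 : F ^ 2 - C B ^ 2 = (X ^ 2 - 1) * (v * w) ^ 2 := by
      linear_combination (F + C B) * h1 + (X + 1) * v ^ 2 * h2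
    rw [h3, ← hqsq, hq]; ring
  have hder := congrArg derivative hpell
  simp [derivative_pow, hC2] at hder
  have h2F' : 2 * derivative F ≠ 0 := mul_ne_zero two_ne_zero hF'0
  refine mul_left_cancel₀ h2F' ?_
  linear_combination -hder

/-- Uniqueness before the substitution `v = u(X + 1)`. -/
lemma odd_add_mul_sq_unique {v₁ v₂ : ℂ[X]} {B₁ B₂ : ℂ} (hv₁ : v₁.Monic) (hv₂ : v₂.Monic)
    (hdeg : v₁.natDegree = v₂.natDegree) (hB₁ : B₁ ≠ 0) (hB₂ : B₂ ≠ 0)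
    (h₁ : (C B₁ + (X + 1) * v₁ ^ 2).comp (-X) = -(C B₁ + (X + 1) * v₁ ^ 2))
    (h₂ : (C B₂ + (X + 1) * v₂ ^ 2).comp (-X) = -(C B₂ + (X + 1) * v₂ ^ 2)) :
    v₁ = v₂ ∧ B₁ = B₂ := by
  have hF : C B₁ + (X + 1) * v₁ ^ 2 = C B₂ + (X + 1) * v₂ ^ 2 :=
    chebyshev_ode_unique (monic_C_add_mul_sq hv₁ B₁) (monic_C_add_mul_sq hv₂ B₂)
      (natDegree_C_add_mul_sq hv₁ B₁) (by rw [natDegree_C_add_mul_sq hv₂ B₂, hdeg])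
      (chebyshev_ode_of_odd hv₁ hB₁ rfl h₁)
      (by rw [hdeg]; exact chebyshev_ode_of_odd hv₂ hB₂ rfl h₂)
  have hB : B₁ = B₂ := by simpa using congrArg (eval (-1)) hF
  refine ⟨?_, hB⟩
  subst hB
  have hX : (X + 1 : ℂ[X]) ≠ 0 := X_add_C_ne_zero 1
  have hsq : v₁ ^ 2 = v₂ ^ 2 := mul_left_cancel₀ hX (add_left_cancel hF)
  refine (sq_eq_sq_iff_eq_or_eq_neg.mp hsq).resolve_right fun h => ?_
  have hlc := congrArg leadingCoeff h
  rw [leadingCoeff_neg, hv₁.leadingCoeff, hv₂.leadingCoeff] at hlc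
  norm_num at hlc

/-- The half-angle formula for Chebyshev polynomials of odd index. -/
lemma chebyshev_T_add_one_eq (n : ℤ) :
    Chebyshev.T ℂ (2 * n + 1) + 1 =
      (X + 1) * (Chebyshev.U ℂ n - Chebyshev.U ℂ (n - 1)) ^ 2 := by
  have hmul := Chebyshev.T_mul_T ℂ (n + 1) n
  rw [show n + 1 + n = 2 * n + 1 by ring, show n + 1 - n = 1 by ring, Chebyshev.T_one] at hmul
  have h0 := Chebyshev.T_eq_U_sub_X_mul_U ℂ n
  have h1 : Chebyshev.T ℂ (n + 1) = X * Chebyshev.U ℂ n - Chebyshev.U ℂ (n - 1) := by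
    simpa [show n - 1 + 2 = n + 1 by ring] using Chebyshev.T_eq_X_mul_U_sub_U ℂ (n - 1)
  have hpell : Chebyshev.U ℂ n ^ 2 + Chebyshev.U ℂ (n - 1) ^ 2 -
      2 * X * Chebyshev.U ℂ n * Chebyshev.U ℂ (n - 1) = 1 := by
    have h := congrArg (fun p => p.comp (2 * X)) (Chebyshev.S_sq_add_S_sq ℂ (n - 1))
    simp only [sub_add_cancel, sub_comp, add_comp, pow_comp, mul_comp, X_comp, one_comp,
      Chebyshev.S_comp_two_mul_X] at h
    linear_combination h
  rw [h0, h1] at hmul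
  linear_combination -hmul + (X - 1) * hpell

lemma chebyshev_T_odd_eq (n : ℤ) :
    Chebyshev.T ℂ (2 * n + 1) =
      X * ((Chebyshev.U ℂ n - Chebyshev.U ℂ (n - 1)).comp (2 * X - 1)).comp (X ^ 2) := by
  have hT (m : ℤ) : Chebyshev.T ℂ (2 * (m + 2) + 1) =
      2 * (2 * X ^ 2 - 1) * Chebyshev.T ℂ (2 * (m + 1) + 1) - Chebyshev.T ℂ (2 * m + 1) := by
    have h := Chebyshev.T_mul_T ℂ (2 * (m + 1) + 1) 2
    rw [Chebyshev.T_two, show 2 * (m + 1) + 1 + 2 = 2 * (m + 2) + 1 by ring,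
      show 2 * (m + 1) + 1 - 2 = 2 * m + 1 by ring] at h
    linear_combination -h
  have hU (m : ℤ) : ((Chebyshev.U ℂ (m + 2)).comp (2 * X - 1)).comp (X ^ 2) =
      2 * (2 * X ^ 2 - 1) * ((Chebyshev.U ℂ (m + 1)).comp (2 * X - 1)).comp (X ^ 2) -
        ((Chebyshev.U ℂ m).comp (2 * X - 1)).comp (X ^ 2) := by
    rw [Chebyshev.U_add_two]; simp
  simp only [sub_comp]
  induction n using Chebyshev.induct with
  | zero => simp
  | one =>
    have h := hT (-1)
    norm_num at h
    norm_num [h]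
    ring
  | add_two n ih1 ih2 =>
    have h0 := hU n
    have h1 := hU (n - 1)
    rw [show (n : ℤ) - 1 + 2 = n + 2 - 1 by ring, show (n : ℤ) - 1 + 1 = n + 1 - 1 by ring] at h1
    linear_combination hT n + 2 * (2 * X ^ 2 - 1) * ih1 - ih2 - X * h0 + X * h1
  | neg_add_one n ih1 ih2 =>
    have h0 := hU (-n - 1)
    have h1 := hU (-n - 1 - 1)
    have h2 := hT (-n - 1)
    rw [show -(n : ℤ) - 1 + 2 = -n + 1 by ring, show -(n : ℤ) - 1 + 1 = -n by ring] at h0 h2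
    rw [show -(n : ℤ) - 1 - 1 + 2 = -n + 1 - 1 by ring,
      show -(n : ℤ) - 1 - 1 + 1 = -n - 1 by ring] at h1
    linear_combination h2 + 2 * (2 * X ^ 2 - 1) * ih1 - ih2 - X * h0 + X * h1

/-- The monic rescaling of the Chebyshev polynomial `U s - U (s - 1)` of the third kind. -/
def monicChebyshevV (s : ℕ) : ℂ[X] :=
  C ((2 : ℂ) ^ s)⁻¹ * (Chebyshev.U ℂ s - Chebyshev.U ℂ (s - 1))

lemma degree_U_sub_one_lt (s : ℕ) :
    (Chebyshev.U ℂ (s - 1)).degree < (Chebyshev.U ℂ s).degree := by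
  rw [Chebyshev.degree_U_natCast]
  cases s with
  | zero => simp
  | succ s =>
    rw [Nat.cast_succ, add_sub_cancel_right, Chebyshev.degree_U_natCast]
    exact_mod_cast s.lt_succ_self

lemma natDegree_monicChebyshevV (s : ℕ) : (monicChebyshevV s).natDegree = s := by
  rw [monicChebyshevV, natDegree_C_mul (by simp), natDegree_eq_of_degree_eq
    (degree_sub_eq_left_of_degree_lt (degree_U_sub_one_lt s)), Chebyshev.natDegree_U_natCast]

lemma monic_monicChebyshevV (s : ℕ) : (monicChebyshevV s).Monic := by
  rw [Monic, monicChebyshevV, leadingCoeff_mul, leadingCoeff_C,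
    leadingCoeff_sub_of_degree_lt (degree_U_sub_one_lt s), Chebyshev.leadingCoeff_U_natCast]
  simp

/-- For each `s ≥ 1` there is exactly one pair `(u, B)` with `u` monic of degree `s` and
`B ≠ 0` for which there exists a monic `u₂` with `B + (x+1)·u(x+1)² = x·u₂(x²)`. -/
theorem unique_typeC_solution (s : ℕ) (hs : 1 ≤ s) :
    ∃! p : ℂ[X] × ℂ, p.1.Monic ∧ p.1.natDegree = s ∧ p.2 ≠ 0 ∧
      ∃ u₂ : ℂ[X], u₂.Monic ∧
        Polynomial.C p.2 + (X + 1) * (p.1.comp (X + 1)) ^ 2 = X * (u₂.comp (X ^ 2)) := by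
  have hdegX : (X + 1 : ℂ[X]).natDegree = 1 := natDegree_X_add_C 1
  have hdegX' : (X - 1 : ℂ[X]).natDegree = 1 := natDegree_X_sub_C 1
  have hmX : (X + 1 : ℂ[X]).Monic := monic_X_add_C 1
  have hmX' : (X - 1 : ℂ[X]).Monic := monic_X_sub_C 1
  have hshift : ∀ u : ℂ[X], (u.comp (X + 1)).comp (X - 1) = u := fun u => by
    simp [comp_assoc]
  have hshift' : ∀ u : ℂ[X], (u.comp (X - 1)).comp (X + 1) = u := fun u => by
    simp [comp_assoc]
  have hexists : ∃ p : ℂ[X] × ℂ, p.1.Monic ∧ p.1.natDegree = s ∧ p.2 ≠ 0 ∧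
      ∃ u₂ : ℂ[X], u₂.Monic ∧
        C p.2 + (X + 1) * (p.1.comp (X + 1)) ^ 2 = X * (u₂.comp (X ^ 2)) := by
    set a : ℂ := ((2 : ℂ) ^ s)⁻¹ with ha
    have hu₂ : C (-a ^ 2) + (X + 1) * (monicChebyshevV s) ^ 2 =
        X * (C a * (monicChebyshevV s).comp (2 * X - 1)).comp (X ^ 2) := by
      have h1 := chebyshev_T_add_one_eq s
      rw [chebyshev_T_odd_eq] at h1
      simp only [monicChebyshevV, ← ha, mul_comp, C_comp, C_neg, C_pow]
      linear_combination -C a ^ 2 * h1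
    refine ⟨((monicChebyshevV s).comp (X - 1), -a ^ 2),
      (monic_monicChebyshevV s).comp hmX' (by rw [hdegX']; exact one_ne_zero), ?_, ?_,
      C a * (monicChebyshevV s).comp (2 * X - 1), ?_, ?_⟩
    · rw [natDegree_comp, hdegX', mul_one, natDegree_monicChebyshevV]
    · simp [ha]
    · have h := monic_C_add_mul_sq (monic_monicChebyshevV s) (-a ^ 2)
      rw [hu₂, Monic, leadingCoeff_mul, leadingCoeff_X, one_mul,
        leadingCoeff_comp (by simp), leadingCoeff_X_pow, one_pow, mul_one] at h
      exact h
    · rw [hshift']; exact hu₂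
  obtain ⟨p, hp⟩ := hexists
  refine ⟨p, hp, ?_⟩
  have hodd : ∀ {F u₂ : ℂ[X]}, F = X * u₂.comp (X ^ 2) → F.comp (-X) = -F := by
    rintro _ u₂ rfl
    simp [comp_assoc]
  obtain ⟨hm, hd, hB, u₂, -, heq⟩ := hp
  rintro q ⟨hm', hd', hB', u₂', -, heq'⟩
  obtain ⟨hu, hBeq⟩ := odd_add_mul_sq_unique (hm'.comp hmX (by rw [hdegX]; exact one_ne_zero))
    (hm.comp hmX (by rw [hdegX]; exact one_ne_zero))
    (by rw [natDegree_comp, natDegree_comp, hd, hd']) hB' hB (hodd heq') (hodd heq)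
  refine Prod.ext ?_ hBeq
  rw [← hshift q.1, hu, hshift]
end
end

section
/- Let n ≥ 3 be an odd integer and let C_n be the degree-n Chebyshev polynomial. Then there exist polynomials u, v, w ∈ ℂ[x] such that C_n(x) = x·u(x²), C_n(x−2) + 2 = x·v(x)², and C_n(x+2) − 2 = x·w(x)², as identities in ℂ[x]. -/
open Polynomial

noncomputable section

/-- `f` is the degree-`n` Chebyshev polynomial: the unique polynomial with
`f(x + 1/x) = x^n + 1/x^n` for all `x ≠ 0`. -/
def IsChebyshev (n : ℕ) (f : ℂ[X]) : Prop :=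
  ∀ x : ℂ, x ≠ 0 → f.eval (x + x⁻¹) = x ^ n + x⁻¹ ^ n

/-- Over `ℂ`, every `t` is of the form `z + z⁻¹`. -/
theorem exists_add_inv_eq (t : ℂ) : ∃ z : ℂ, z ≠ 0 ∧ z + z⁻¹ = t := by
  obtain ⟨s, hs⟩ := IsAlgClosed.exists_pow_nat_eq (t ^ 2 - 4) (n := 2) (by norm_num)
  have hz : (t + s) / 2 * ((t - s) / 2) = 1 := by linear_combination -hs / 4
  refine ⟨(t + s) / 2, left_ne_zero_of_mul_eq_one hz, ?_⟩
  rw [inv_eq_of_mul_eq_one_right hz]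
  ring

/-- A polynomial is determined by its values at the points `z + z⁻¹`. -/
theorem Polynomial.ext_of_eval_add_inv {p q : ℂ[X]}
    (h : ∀ z : ℂ, z ≠ 0 → p.eval (z + z⁻¹) = q.eval (z + z⁻¹)) : p = q := by
  refine Polynomial.funext fun t => ?_
  obtain ⟨z, hz, rfl⟩ := exists_add_inv_eq t
  exact h z hz

theorem exists_eval_add_inv_sq (m : ℕ) : ∃ u : ℂ[X], ∀ z w : ℂ, z * w = 1 →
    (z + w) * u.eval ((z + w) ^ 2) = z ^ (2 * m + 1) + w ^ (2 * m + 1) := by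
  induction m using Nat.twoStepInduction with
  | zero => exact ⟨1, fun z w _ => by simp⟩
  | one =>
    refine ⟨X - 3, fun z w h => ?_⟩
    simp only [eval_sub, eval_X, eval_ofNat]
    linear_combination 3 * (z + w) * h
  | more m ih₀ ih₁ =>
    obtain ⟨a, ha⟩ := ih₀
    obtain ⟨b, hb⟩ := ih₁
    refine ⟨(X - 2) * b - a, fun z w h => ?_⟩
    simp only [eval_sub, eval_mul, eval_X, eval_ofNat]
    have e : z ^ 2 * w ^ 2 = 1 := by rw [← mul_pow, h, one_pow]
    linear_combination ((z + w) ^ 2 - 2) * hb z w h - ha z w h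
      + 2 * (z ^ (2 * m + 3) + w ^ (2 * m + 3)) * h
      + (z ^ (2 * m + 1) + w ^ (2 * m + 1)) * e

theorem exists_eval_add_inv_mul_sub_one (m : ℕ) : ∃ p : ℂ[X], ∀ z w : ℂ, z * w = 1 →
    p.eval (z + w) * (z - 1) = z ^ (m + 1) - w ^ m := by
  induction m using Nat.twoStepInduction with
  | zero => exact ⟨1, fun z w _ => by simp⟩
  | one =>
    refine ⟨X + 1, fun z w h => ?_⟩
    simp only [eval_add, eval_X, eval_one]
    linear_combination h
  | more m ih₀ ih₁ =>
    obtain ⟨a, ha⟩ := ih₀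
    obtain ⟨b, hb⟩ := ih₁
    refine ⟨X * b - a, fun z w h => ?_⟩
    simp only [eval_sub, eval_mul, eval_X]
    linear_combination (z + w) * hb z w h - ha z w h + (z ^ (m + 1) - w ^ m) * h

namespace IsChebyshev

theorem exists_eq_X_mul_comp {m : ℕ} {f : ℂ[X]} (hf : IsChebyshev (2 * m + 1) f) :
    ∃ u : ℂ[X], f = X * u.comp (X ^ 2) := by
  obtain ⟨u, hu⟩ := exists_eval_add_inv_sq m
  refine ⟨u, ext_of_eval_add_inv fun z hz => ?_⟩
  simp [hf z hz, eval_comp, hu z z⁻¹ (mul_inv_cancel₀ hz)]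

theorem exists_sub_two_eq {m : ℕ} {f : ℂ[X]} (hf : IsChebyshev (2 * m + 1) f) :
    ∃ p : ℂ[X], f - 2 = (X - 2) * p ^ 2 := by
  obtain ⟨p, hp⟩ := exists_eval_add_inv_mul_sub_one m
  refine ⟨p, ext_of_eval_add_inv fun z hz => ?_⟩
  have h := mul_inv_cancel₀ hz
  have e := hp z z⁻¹ h
  simp only [eval_sub, eval_mul, eval_X, eval_pow, eval_ofNat, hf z hz]
  generalize z⁻¹ = w at *
  have hm : z ^ m * w ^ m = 1 := by rw [← mul_pow, h, one_pow]
  have hq : z + w - 2 = w * (z - 1) ^ 2 := by linear_combination (2 - z) * h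
  rw [hq, mul_assoc, ← mul_pow, mul_comm (z - 1), e]
  linear_combination 2 * h * z ^ m * w ^ m + 2 * hm - z ^ (2 * m + 1) * h

end IsChebyshev

/-- For odd `n ≥ 3`, the Chebyshev polynomial `C_n` is an odd function,
`C_n(x) = x·u(x²)`, and its translation conjugates satisfy
`C_n(x−2) + 2 = x·v(x)²` and `C_n(x+2) − 2 = x·w(x)²`. -/
theorem chebyshev_conjugate_forms (n : ℕ) (hn : 3 ≤ n) (hodd : Odd n)
    (Cn : ℂ[X]) (hC : IsChebyshev n Cn) :
    ∃ u v w : ℂ[X],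
      Cn = X * (u.comp (X ^ 2)) ∧
      Cn.comp (X - 2) + 2 = X * v ^ 2 ∧
      Cn.comp (X + 2) - 2 = X * w ^ 2 := by
  obtain ⟨m, rfl⟩ := hodd
  obtain ⟨u, hu⟩ := hC.exists_eq_X_mul_comp
  obtain ⟨p, hp⟩ := hC.exists_sub_two_eq
  refine ⟨u, p.comp (2 - X), p.comp (X + 2), hu, Polynomial.funext fun t => ?_,
    Polynomial.funext fun t => ?_⟩
  · have h₁ := congrArg (eval (t - 2)) hu
    have h₂ := congrArg (eval (2 - t)) hu
    have h₃ := congrArg (eval (2 - t)) hp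
    simp only [eval_sub, eval_add, eval_mul, eval_X, eval_pow, eval_ofNat, eval_comp] at h₁ h₂ h₃ ⊢
    rw [show (2 - t) ^ 2 = (t - 2) ^ 2 by ring] at h₂
    linear_combination h₁ + h₂ - h₃
  · have h := congrArg (eval (t + 2)) hp
    simp only [eval_sub, eval_add, eval_mul, eval_X, eval_pow, eval_ofNat, eval_comp] at h ⊢
    linear_combination h
end
end

section
/- Let m, n ≥ 2 be integers, neither of which is a power of 2, and let C_m, C_n, C_{mn} be Chebyshev polynomials. Suppose A, B, C, D are linear polynomials over ℂ, f = B ∘ C_m ∘ A, g = D ∘ C_n ∘ C, and there exist linear polynomials L, M with L ∘ g ∘ f ∘ M = C_{m·n}. Then C ∘ B = x or C ∘ B = −x (i.e. C ∘ B is the scaling by ±1). -/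
open Polynomial

noncomputable section

/-- A linear polynomial `L(x) = Ax + B` with `A ≠ 0`, i.e. of degree exactly 1. -/
def IsLinearPoly (L : ℂ[X]) : Prop := L.natDegree = 1

theorem IsChebyshev.eq_chebyshev {n : ℕ} {f : ℂ[X]} (hf : IsChebyshev n f) :
    f = Chebyshev.C ℂ n := by
  refine Polynomial.funext fun z => ?_
  obtain ⟨t, ht⟩ := IsAlgClosed.exists_root (X ^ 2 - C z * X + 1 : ℂ[X]) (by
    have : (X ^ 2 - C z * X + 1 : ℂ[X]).degree = 2 := by compute_degree!
    rw [this]; decide)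
  have ht' : t ^ 2 - z * t + 1 = 0 := by simpa using ht
  have h0 : t ≠ 0 := by rintro rfl; simp at ht'
  have hz : z = t + t⁻¹ := by field_simp; linear_combination -ht'
  rw [hz, hf t h0, ← dickson_one_one_eq_chebyshev_C,
    dickson_one_one_eval_add_inv _ _ (mul_inv_cancel₀ h0)]

theorem IsLinearPoly.exists_eq {L : ℂ[X]} (hL : IsLinearPoly L) :
    ∃ a b : ℂ, a ≠ 0 ∧ L = C a * X + C b := by
  refine ⟨L.coeff 1, L.coeff 0, ?_, eq_X_add_C_of_natDegree_le_one hL.le⟩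
  have h : L.leadingCoeff ≠ 0 := by
    intro h
    rw [leadingCoeff_eq_zero] at h
    simp [IsLinearPoly, h] at hL
  rwa [leadingCoeff, hL] at h

theorem IsLinearPoly.comp {L M : ℂ[X]} (hL : IsLinearPoly L) (hM : IsLinearPoly M) :
    IsLinearPoly (L.comp M) := by
  unfold IsLinearPoly at *
  rw [natDegree_comp, hL, hM]

theorem natDegree_chebyshev_C_le (k : ℕ) : (Chebyshev.C ℂ k).natDegree ≤ k := by
  induction k using Nat.twoStepInduction with
  | zero => rw [Nat.cast_zero, Chebyshev.C_zero]; exact (natDegree_ofNat 2).le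
  | one => simp
  | more k h0 h1 =>
    push_cast at h1 ⊢
    rw [Chebyshev.C_add_two]
    refine (natDegree_sub_le _ _).trans (max_le ?_ (by omega))
    refine natDegree_mul_le.trans ?_
    rw [natDegree_X]
    omega

theorem chebyshev_C_coeff (k : ℕ) :
    (Chebyshev.C ℂ (k + 1 : ℕ)).coeff (k + 1) = 1 ∧ (Chebyshev.C ℂ (k + 1 : ℕ)).coeff k = 0 ∧
      (Chebyshev.C ℂ (k + 2 : ℕ)).coeff k = -(k + 2) := by
  have hrec (j i : ℕ) : (Chebyshev.C ℂ (j + 2 : ℕ)).coeff (i + 1) =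
      (Chebyshev.C ℂ (j + 1 : ℕ)).coeff i - (Chebyshev.C ℂ j).coeff (i + 1) := by
    push_cast
    rw [Chebyshev.C_add_two, coeff_sub, coeff_X_mul]
  have big (j i : ℕ) (h : j < i) : (Chebyshev.C ℂ j).coeff i = 0 :=
    coeff_eq_zero_of_natDegree_lt ((natDegree_chebyshev_C_le j).trans_lt h)
  induction k with
  | zero =>
    have : (Chebyshev.C ℂ 2).coeff 0 = -2 := by
      rw [Chebyshev.C_two, coeff_zero_eq_eval_zero]; simp
    simpa using this
  | succ k ih =>
    obtain ⟨h1, h2, h3⟩ := ih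
    refine ⟨?_, ?_, ?_⟩
    · rw [hrec k (k + 1), h1, big _ _ (by omega), sub_zero]
    · rw [hrec k k, h2, big _ _ (by omega), sub_zero]
    · rw [hrec (k + 1) k, h3, h1]; push_cast; ring

theorem natDegree_chebyshev_C (k : ℕ) : (Chebyshev.C ℂ k).natDegree = k := by
  cases k with
  | zero => exact Nat.le_zero.mp (natDegree_chebyshev_C_le 0)
  | succ k =>
    refine natDegree_eq_of_le_of_coeff_ne_zero (natDegree_chebyshev_C_le _) ?_
    rw [(chebyshev_C_coeff k).1]
    exact one_ne_zero

/-- The only affine self-equivalences of a Chebyshev polynomial of degree at least 3 are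
the sign changes. -/
theorem chebyshev_C_comp_linear {m : ℕ} (hm : 3 ≤ m) {a b c d : ℂ} (ha : a ≠ 0)
    (h : (Chebyshev.C ℂ m).comp (C a * X + C b) = C c * Chebyshev.C ℂ m + C d) :
    a ^ 2 = 1 ∧ b = 0 ∧ c ^ 2 = 1 ∧ d = 0 := by
  obtain ⟨k, rfl⟩ : ∃ k, m = k + 3 := ⟨m - 3, by omega⟩
  set P := Chebyshev.C ℂ (k + 3 : ℕ) with hP
  have e1 : P.coeff (k + 3) = 1 := (chebyshev_C_coeff (k + 2)).1
  have e2 : P.coeff (k + 2) = 0 := (chebyshev_C_coeff (k + 2)).2.1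
  have e3 : P.coeff (k + 1) = -(k + 3) := by
    rw [hP, (chebyshev_C_coeff (k + 1)).2.2]; push_cast; ring
  have hdeg : P.natDegree ≤ k + 3 := natDegree_chebyshev_C_le _
  have hQ : (P - X ^ (k + 3)).natDegree ≤ k + 1 := by
    rw [natDegree_le_iff_coeff_eq_zero]
    intro N hN
    rw [coeff_sub, coeff_X_pow]
    rcases (by omega : N = k + 2 ∨ N = k + 3 ∨ k + 3 < N) with rfl | rfl | hN
    · simp [e2]
    · simp [e1]
    · rw [coeff_eq_zero_of_natDegree_lt (hdeg.trans_lt hN), if_neg (by omega), sub_zero]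
  have hb : b = 0 := by
    have hcomp : P.comp (C a * X + C b) =
        (P - X ^ (k + 3)).comp (C a * X + C b) + (C a * (X + C (b / a))) ^ (k + 3) := by
      rw [mul_add, ← C_mul, mul_div_cancel₀ _ ha]
      simp
    have hlow : ((P - X ^ (k + 3)).comp (C a * X + C b)).natDegree < k + 2 := by
      refine natDegree_comp_le.trans_lt ?_
      rw [natDegree_linear ha, mul_one]
      omega
    have h2 := congrArg (fun p => coeff p (k + 2)) h
    simp only [hcomp, coeff_add, coeff_C_mul, e2, mul_pow, ← C_pow,
      coeff_eq_zero_of_natDegree_lt hlow, coeff_X_add_C_pow, coeff_C_succ] at h2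
    have hch : (k + 3).choose (k + 2) = k + 3 := Nat.choose_succ_self_right (k + 2)
    have hk : ((k + 3 : ℕ) : ℂ) ≠ 0 := Nat.cast_ne_zero.mpr (by omega)
    rw [hch, show k + 3 - (k + 2) = 1 by omega, pow_one] at h2
    simpa only [mul_zero, add_zero, zero_add, mul_eq_zero, pow_ne_zero _ ha, hk,
      div_eq_zero_iff, ha, or_false, false_or] using h2
  subst hb
  have hcoeff (i : ℕ) : P.coeff i * a ^ i = c * P.coeff i + (C d).coeff i := by
    have := congrArg (fun p => coeff p i) h
    simpa [comp_C_mul_X_coeff] using this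
  have h3 := hcoeff (k + 3)
  have h1 := hcoeff (k + 1)
  rw [e1, coeff_C_succ, one_mul, mul_one, add_zero] at h3
  rw [e3, coeff_C_succ, add_zero, mul_comm] at h1
  have hk : (-(k + 3) : ℂ) ≠ 0 := by
    rw [neg_ne_zero]; exact_mod_cast (by omega : k + 3 ≠ 0)
  have h1' : a ^ (k + 1) = c := mul_right_cancel₀ hk h1
  have ha2 : a ^ 2 = 1 := by
    refine mul_left_cancel₀ (pow_ne_zero (k + 1) ha) ?_
    rw [← pow_add, mul_one, h1', ← h3]
  have hc2 : c ^ 2 = 1 := by rw [← h1', ← pow_mul, mul_comm, pow_mul, ha2, one_pow]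
  refine ⟨ha2, rfl, hc2, ?_⟩
  rcases Nat.even_or_odd k with hk2 | hk2
  · have h0 := hcoeff 0
    have hc : c = a := by
      obtain ⟨j, rfl⟩ := hk2
      rw [← h1', pow_succ, ← two_mul, pow_mul, ha2, one_pow, one_mul]
    have hP0 : P.coeff 0 = 0 := by
      have hev : P.eval (Complex.I + Complex.I⁻¹) =
          Complex.I ^ (k + 3) + Complex.I⁻¹ ^ (k + 3) := by
        rw [hP, ← dickson_one_one_eq_chebyshev_C,
          dickson_one_one_eval_add_inv _ _ (mul_inv_cancel₀ Complex.I_ne_zero)]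
      have hodd : Odd (k + 3) := hk2.add_odd (by decide)
      rw [Complex.inv_I, hodd.neg_pow, add_neg_cancel, add_neg_cancel] at hev
      rwa [coeff_zero_eq_eval_zero]
    simpa [hP0] using h0.symm
  · have h0 := hcoeff 0
    have hc : c = 1 := by
      obtain ⟨j, rfl⟩ := hk2
      rw [← h1', show 2 * j + 1 + 1 = 2 * (j + 1) by ring, pow_mul, ha2, one_pow]
    simpa [hc] using h0.symm

/-- Two right factors with equal leading coefficients differ by a constant. -/
theorem natDegree_sub_eq_zero_of_comp_eq_comp {n m : ℕ} (hn : 0 < n) (hm : 0 < m)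
    {F F' G G' : ℂ[X]} (hF : F.natDegree = m) (hF' : F'.natDegree = m)
    (hG : G.natDegree = n) (hG' : G'.natDegree = n)
    (hlead : F.leadingCoeff = F'.leadingCoeff) (h : G.comp F = G'.comp F') :
    (F - F').natDegree = 0 := by
  by_contra hne
  have hF0 : F.leadingCoeff ≠ 0 := by
    rw [Ne, leadingCoeff_eq_zero]; rintro rfl; simp at hF; omega
  have hG0 : G.leadingCoeff ≠ 0 := by
    rw [Ne, leadingCoeff_eq_zero]; rintro rfl; simp at hG; omega
  have hlc : G.leadingCoeff = G'.leadingCoeff := by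
    have := congrArg leadingCoeff h
    rw [leadingCoeff_comp (by omega), leadingCoeff_comp (by omega), hG, hG', ← hlead] at this
    exact mul_right_cancel₀ (pow_ne_zero n hF0) this
  set S := ∑ i ∈ Finset.range n, F ^ i * F' ^ (n - 1 - i) with hS
  have hterm (i : ℕ) (hi : i ∈ Finset.range n) :
      (F ^ i * F' ^ (n - 1 - i)).natDegree ≤ (n - 1) * m ∧
      (F ^ i * F' ^ (n - 1 - i)).coeff ((n - 1) * m) = F.leadingCoeff ^ (n - 1) := by
    have hi' : i + (n - 1 - i) = n - 1 := by have := Finset.mem_range.mp hi; omega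
    have hd : (F ^ i * F' ^ (n - 1 - i)).natDegree = (n - 1) * m := by
      rw [natDegree_mul, natDegree_pow, natDegree_pow, hF, hF', ← add_mul, hi']
      · exact pow_ne_zero _ (leadingCoeff_ne_zero.mp hF0)
      · exact pow_ne_zero _ (leadingCoeff_ne_zero.mp (hlead ▸ hF0))
    refine ⟨hd.le, ?_⟩
    rw [← hd, coeff_natDegree, leadingCoeff_mul, leadingCoeff_pow, leadingCoeff_pow, ← hlead,
      ← pow_add, hi']
  have hSc : S.coeff ((n - 1) * m) ≠ 0 := by
    rw [hS, finsetSum_coeff, Finset.sum_congr rfl fun i hi => (hterm i hi).2, Finset.sum_const,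
      Finset.card_range, nsmul_eq_mul]
    exact mul_ne_zero (Nat.cast_ne_zero.mpr hn.ne') (pow_ne_zero _ hF0)
  have hSd : S.natDegree = (n - 1) * m :=
    natDegree_eq_of_le_of_coeff_ne_zero
      (natDegree_sum_le_of_forall_le _ _ fun i hi => (hterm i hi).1) hSc
  have hkey : C G.leadingCoeff * (S * (F - F')) =
      G'.eraseLead.comp F' - G.eraseLead.comp F := by
    have hg := congrArg (fun p => p.comp F) G.eraseLead_add_C_mul_X_pow
    have hg' := congrArg (fun p => p.comp F') G'.eraseLead_add_C_mul_X_pow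
    simp only [add_comp, mul_comp, C_comp, pow_comp, X_comp, hG, hG', ← hlc] at hg hg'
    rw [hS, (Commute.all F F').geom_sum₂_mul]
    linear_combination hg - hg' + h
  have hlow {Q R : ℂ[X]} (hQ : Q.natDegree = n) (hR : R.natDegree = m) :
      (Q.eraseLead.comp R).natDegree ≤ (n - 1) * m := by
    refine natDegree_comp_le.trans ?_
    rw [hR]
    exact Nat.mul_le_mul_right _ (hQ ▸ eraseLead_natDegree_le Q)
  have hle : (C G.leadingCoeff * (S * (F - F'))).natDegree ≤ (n - 1) * m := by
    rw [hkey]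
    exact (natDegree_sub_le _ _).trans (max_le (hlow hG' hF') (hlow hG hF))
  rw [natDegree_C_mul hG0, natDegree_mul, hSd] at hle
  · omega
  · rintro h0; exact hSc (by rw [h0, coeff_zero])
  · rintro h0; exact hne (by rw [h0, natDegree_zero])

/-- Right factors of equal degree in a composition are unique up to a linear change. -/
theorem exists_linear_of_comp_eq_comp {n m : ℕ} (hn : 0 < n) (hm : 0 < m)
    {F F' G G' : ℂ[X]} (hF : F.natDegree = m) (hF' : F'.natDegree = m)
    (hG : G.natDegree = n) (hG' : G'.natDegree = n) (h : G.comp F = G'.comp F') :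
    ∃ c d : ℂ, c ≠ 0 ∧ F' = C c * F + C d := by
  have hF0 : F.leadingCoeff ≠ 0 := by
    rw [Ne, leadingCoeff_eq_zero]; rintro rfl; simp at hF; omega
  have hFp : F'.leadingCoeff ≠ 0 := by
    rw [Ne, leadingCoeff_eq_zero]; rintro rfl; simp at hF'; omega
  set c := F'.leadingCoeff / F.leadingCoeff with hc
  have hc0 : c ≠ 0 := div_ne_zero hFp hF0
  have hz := natDegree_sub_eq_zero_of_comp_eq_comp (F := C c * F) (F' := F')
    (G := G.comp (C c⁻¹ * X)) (G' := G') hn hm (by rw [natDegree_C_mul hc0, hF]) hF'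
    (by rw [natDegree_comp, natDegree_C_mul_X _ (inv_ne_zero hc0), hG, mul_one]) hG'
    (by rw [leadingCoeff_mul, leadingCoeff_C, hc, div_mul_cancel₀ _ hF0])
    (by
      rw [comp_assoc, ← h, mul_comp, C_comp, X_comp, ← mul_assoc, ← C_mul, inv_mul_cancel₀ hc0,
        C_1, one_mul])
  obtain ⟨d, hd⟩ := natDegree_eq_zero.mp hz
  exact ⟨c, -d, hc0, by rw [C_neg, hd]; ring⟩

/-- **Chebyclump concatenation lemma.**  If `f = B ∘ C_m ∘ A` and `g = D ∘ C_n ∘ E`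
with `m, n ≥ 2` not powers of 2, and `L ∘ g ∘ f ∘ M = C_{mn}` for some linear `L, M`,
then `E ∘ B = ±x`. -/
theorem chebyclump_concatenation (m n : ℕ) (hm : 2 ≤ m) (hn : 2 ≤ n)
    (hm2 : ¬ ∃ j : ℕ, m = 2 ^ j) (hn2 : ¬ ∃ j : ℕ, n = 2 ^ j)
    (Cm Cn Cmn A B E D f g L M : ℂ[X])
    (hCm : IsChebyshev m Cm) (hCn : IsChebyshev n Cn) (hCmn : IsChebyshev (m * n) Cmn)
    (hA : IsLinearPoly A) (hB : IsLinearPoly B) (hE : IsLinearPoly E) (hD : IsLinearPoly D)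
    (hL : IsLinearPoly L) (hM : IsLinearPoly M)
    (hf : f = B.comp (Cm.comp A)) (hg : g = D.comp (Cn.comp E))
    (hLM : L.comp (g.comp (f.comp M)) = Cmn) :
    E.comp B = X ∨ E.comp B = -X := by
  obtain rfl := hCm.eq_chebyshev
  obtain rfl := hCn.eq_chebyshev
  obtain rfl := hCmn.eq_chebyshev
  have three_le {k : ℕ} (hk : 2 ≤ k) (hk2 : ¬ ∃ j : ℕ, k = 2 ^ j) : 3 ≤ k :=
    lt_of_le_of_ne hk fun h => hk2 ⟨1, by omega⟩
  have hLD := hL.comp hD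
  have hEB := hE.comp hB
  have hAM := hA.comp hM
  have hmain : (((L.comp D).comp (Chebyshev.C ℂ n)).comp (E.comp B)).comp
      ((Chebyshev.C ℂ m).comp (A.comp M)) = (Chebyshev.C ℂ n).comp (Chebyshev.C ℂ m) := by
    rw [← Chebyshev.C_mul, mul_comm (n : ℤ), ← Nat.cast_mul, ← hLM, hf, hg]
    simp only [comp_assoc]
  generalize L.comp D = l at hLD hmain
  generalize E.comp B = μ at hEB hmain ⊢
  generalize A.comp M = ν at hAM hmain
  obtain ⟨c, d, hc0, hcd⟩ := exists_linear_of_comp_eq_comp (n := n) (m := m) (by omega) (by omega)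
    (natDegree_chebyshev_C m)
    (by rw [natDegree_comp, natDegree_chebyshev_C, hAM, mul_one]) (natDegree_chebyshev_C n)
    (by rw [natDegree_comp, natDegree_comp, natDegree_chebyshev_C, hLD, hEB, mul_one, one_mul])
    hmain.symm
  obtain ⟨a, b, ha, rfl⟩ := hAM.exists_eq
  obtain ⟨-, -, hc2, rfl⟩ := chebyshev_C_comp_linear (three_le hm hm2) ha hcd
  obtain ⟨p, q, hp, rfl⟩ := hLD.exists_eq
  obtain ⟨u, v, hu, rfl⟩ := hEB.exists_eq
  have hcomp : ((C p * X + C q).comp (Chebyshev.C ℂ n)).comp (C (u * c) * X + C v) =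
      Chebyshev.C ℂ n := by
    rw [hcd, C_0, add_zero] at hmain
    rw [← sub_eq_zero]
    have hz : (((C p * X + C q).comp (Chebyshev.C ℂ n)).comp (C (u * c) * X + C v) -
        Chebyshev.C ℂ n).comp (Chebyshev.C ℂ m) = 0 := by
      rw [sub_comp, sub_eq_zero, ← hmain]
      simp only [comp_assoc, add_comp, mul_comp, C_comp, X_comp, C_mul, mul_assoc]
    refine (comp_eq_zero_iff.mp hz).resolve_right fun h => ?_
    have := congrArg natDegree h.2
    rw [natDegree_chebyshev_C, natDegree_C] at this
    omega
  have hn' : (Chebyshev.C ℂ n).comp (C (u * c) * X + C v) =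
      C p⁻¹ * Chebyshev.C ℂ n + C (-(p⁻¹ * q)) := by
    have hpp : (C p⁻¹ * C p : ℂ[X]) = 1 := by rw [← C_mul, inv_mul_cancel₀ hp, C_1]
    rw [comp_assoc, add_comp, mul_comp, C_comp, X_comp, C_comp] at hcomp
    rw [C_neg, C_mul (a := p⁻¹)]
    linear_combination C p⁻¹ * hcomp - (Chebyshev.C ℂ n).comp (C (u * c) * X + C v) * hpp
  obtain ⟨hu2, rfl, -, -⟩ := chebyshev_C_comp_linear (three_le hn hn2) (mul_ne_zero hu hc0) hn'
  rw [mul_pow, hc2, mul_one] at hu2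
  rcases eq_or_eq_neg_of_sq_eq_sq u 1 (by rw [hu2, one_pow]) with rfl | rfl
  · left; simp
  · right; simp
end
end

section
/- Let K be an algebraically closed field of characteristic zero and let λ_1, …, λ_r ∈ K^× be multiplicatively independent, i.e. the only tuple of integers (m_1, …, m_r) with λ_1^{m_1}·⋯·λ_r^{m_r} = 1 is the zero tuple. Let a_1, …, a_r ∈ K^× and b ∈ K. Then for every nonzero polynomial G ∈ K[x_1, …, x_r, y] there exists a natural number n such that G(λ_1^n a_1, …, λ_r^n a_r, b + n) ≠ 0. Equivalently, the forward orbit of (a_1, …, a_r, b) under the map (x_1,…,x_r,y) ↦ (λ_1 x_1, …, λ_r x_r, y+1) is Zariski dense in affine (r+1)-space. -/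
open scoped BigOperators

/-- Powers of `shift - μ` act on exponential polynomials through forward differences. -/
lemma shift_sub_pow_apply_exponential {K : Type*} [Field K] (μ b : K) (f : K → K) (k : ℕ) :
    ((LinearMap.funLeft K K Nat.succ - μ • (1 : Module.End K (ℕ → K))) ^ k)
        (fun n : ℕ => μ ^ n * f (b + n)) =
      fun n : ℕ => μ ^ (n + k) * (fwdDiff 1)^[k] f (b + n) := by
  induction k with
  | zero => simp
  | succ k ih =>
    rw [pow_succ', Module.End.mul_apply, ih, Function.iterate_succ_apply']
    funext n
    simp only [LinearMap.sub_apply, LinearMap.smul_apply, Module.End.one_apply, Pi.sub_apply,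
      Pi.smul_apply, LinearMap.funLeft_apply, fwdDiff, smul_eq_mul, Nat.succ_eq_add_one,
      Nat.cast_add, Nat.cast_one, add_assoc]
    ring

/-- A polynomial multiple of `n ↦ μ ^ n` is a generalized eigenvector of the shift operator. -/
lemma exponential_mul_eval_mem_maxGenEigenspace {K : Type*} [Field K] (μ b : K)
    (p : Polynomial K) :
    (fun n : ℕ => μ ^ n * p.eval (b + n)) ∈
      Module.End.maxGenEigenspace (LinearMap.funLeft K K Nat.succ : Module.End K (ℕ → K)) μ := by
  rw [Module.End.mem_maxGenEigenspace]
  refine ⟨p.natDegree + 1, ?_⟩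
  rw [shift_sub_pow_apply_exponential μ b (fun x => p.eval x),
    Polynomial.fwdDiff_iter_degree_add_one_eq_zero]
  funext n
  simp

/-- A polynomial over a field of characteristic zero that vanishes on `b + ℕ` is zero. -/
lemma Polynomial.eq_zero_of_eval_add_natCast_eq_zero {K : Type*} [Field K] [CharZero K] (b : K)
    (p : Polynomial K) (h : ∀ n : ℕ, p.eval (b + n) = 0) : p = 0 := by
  refine p.eq_zero_of_infinite_isRoot ((Set.infinite_range_of_injective
    (f := fun n : ℕ => b + (n : K)) fun m n hmn => ?_).mono ?_)
  · exact_mod_cast add_left_cancel hmn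
  · rintro _ ⟨n, rfl⟩
    exact h n

/-- Exponential polynomials with distinct nonzero bases are linearly independent. -/
lemma eq_zero_of_sum_exponential_mul_eval_eq_zero {K ι : Type*} [Field K] [CharZero K]
    (s : Finset ι) (μ : ι → K) (hμ : Function.Injective μ) (hμ0 : ∀ i, μ i ≠ 0) (b : K)
    (p : ι → Polynomial K) (h : ∀ n : ℕ, ∑ i ∈ s, μ i ^ n * (p i).eval (b + n) = 0) :
    ∀ i ∈ s, p i = 0 := by
  intro i hi
  have hind := (Module.End.independent_maxGenEigenspace
    (LinearMap.funLeft K K Nat.succ : Module.End K (ℕ → K))).comp hμ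
  have hzero := (iSupIndep_iff_finsetSum_eq_zero_imp_eq_zero _).1 hind s
    (fun i n => μ i ^ n * (p i).eval (b + n))
    (fun i _ => exponential_mul_eval_mem_maxGenEigenspace (μ i) b (p i))
    (by funext n; simpa using h n) i hi
  refine (p i).eq_zero_of_eval_add_natCast_eq_zero b fun n => ?_
  exact (mul_eq_zero.1 (congrFun hzero n)).resolve_left (pow_ne_zero _ (hμ0 i))

/-- Evaluation of a polynomial through its expansion in monomials in the variables `some i` with
coefficients polynomials in the variable `none`. -/
lemma MvPolynomial.eval_option_eq_sum {K σ : Type*} [Field K] [Fintype σ] (x : σ → K) (y : K)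
    (G : MvPolynomial (Option σ) K) :
    MvPolynomial.eval (fun j => j.elim y x) G =
      ∑ m ∈ (MvPolynomial.optionEquivRight K σ G).support,
        ((MvPolynomial.optionEquivRight K σ G).coeff m).eval y * ∏ i, x i ^ m i := by
  have h : MvPolynomial.eval (fun j => j.elim y x) =
      (MvPolynomial.eval₂Hom (Polynomial.evalRingHom y) x).comp
        (MvPolynomial.optionEquivRight K σ : MvPolynomial (Option σ) K →+* _) := by
    refine MvPolynomial.ringHom_ext (fun c => ?_) fun j => ?_
    · simp
    · cases j <;> simp
  rw [h]
  simp [MvPolynomial.eval₂_eq']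

/-- **Density of orbits for semisimple-plus-translation linear dynamics.**
If `λ₁, …, λ_r` are multiplicatively independent elements of an algebraically closed
field `K` of characteristic zero, then the forward orbit of any point
`(a₁, …, a_r, b)` with all `aᵢ ≠ 0` under
`(x₁, …, x_r, y) ↦ (λ₁x₁, …, λ_r x_r, y+1)` is Zariski dense: every nonzero polynomial
`G` in the variables `x₁, …, x_r, y` is nonvanishing at some orbit point. -/
theorem linear_orbit_dense (K : Type*) [Field K] [IsAlgClosed K] [CharZero K]
    (r : ℕ) (lam : Fin r → K) (hlam : ∀ i, lam i ≠ 0)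
    (hindep : ∀ m : Fin r → ℤ, (∏ i, lam i ^ m i) = 1 → ∀ i, m i = 0)
    (a : Fin r → K) (ha : ∀ i, a i ≠ 0) (b : K)
    (G : MvPolynomial (Option (Fin r)) K) (hG : G ≠ 0) :
    ∃ n : ℕ, MvPolynomial.eval
        (fun j => j.elim (b + n) (fun i => lam i ^ n * a i)) G ≠ 0 := by
  by_contra! hvanish
  set g := MvPolynomial.optionEquivRight K (Fin r) G with hg
  have hinj : Function.Injective fun m : Fin r →₀ ℕ => ∏ i, lam i ^ m i := by
    intro m m' hmm
    have hne : ∏ i, lam i ^ m' i ≠ 0 :=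
      Finset.prod_ne_zero_iff.2 fun i _ => pow_ne_zero _ (hlam i)
    have hone : ∏ i, lam i ^ ((m i : ℤ) - m' i) = 1 := by
      simp only [zpow_sub₀ (hlam _), zpow_natCast, Finset.prod_div_distrib]
      exact (div_eq_one_iff_eq hne).2 hmm
    ext i
    have := hindep _ hone i
    omega
  have hcoeff := eq_zero_of_sum_exponential_mul_eval_eq_zero g.support
    (fun m => ∏ i, lam i ^ m i) hinj
    (fun m => Finset.prod_ne_zero_iff.2 fun i _ => pow_ne_zero _ (hlam i)) b
    (fun m => Polynomial.C (∏ i, a i ^ m i) * g.coeff m) (fun n => by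
      rw [← hvanish n, MvPolynomial.eval_option_eq_sum, ← hg]
      refine Finset.sum_congr rfl fun m _ => ?_
      simp only [mul_pow, Finset.prod_mul_distrib, Polynomial.eval_mul, Polynomial.eval_C,
        ← Finset.prod_pow, pow_right_comm _ n]
      ring)
  have hg0 : g ≠ 0 :=
    (EmbeddingLike.map_ne_zero_iff (f := MvPolynomial.optionEquivRight K (Fin r))).2 hG
  obtain ⟨m, hm⟩ := MvPolynomial.support_nonempty.2 hg0
  refine (mul_ne_zero ?_ (MvPolynomial.mem_support_iff.1 hm)) (hcoeff m hm)
  exact Polynomial.C_ne_zero.2 (Finset.prod_ne_zero_iff.2 fun i _ => pow_ne_zero _ (ha i))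
end

section
/- Let K be a field of characteristic zero and let f_1, …, f_n ∈ K[x] be polynomials each of degree at least 2. Define Φ : K^n → K^n by Φ(x_1, …, x_n) = (f_1(x_1), …, f_n(x_n)). Then there exists a point a ∈ K^n whose forward orbit {Φ^{∘m}(a) : m ∈ ℕ} is Zariski dense in affine n-space, i.e. the only polynomial G ∈ K[x_1, …, x_n] with G(Φ^{∘m}(a)) = 0 for every m ∈ ℕ is the zero polynomial. -/
open Polynomial

/-- `T` preserves the residue class `ζ + I` and is, modulo higher powers of `I`, linear with
multiplier `c` there. -/
def IsCongLinear {R : Type*} [CommRing R] (I : Ideal R) (ζ c : R) (T : R → R) : Prop :=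
  (∀ y, y - ζ ∈ I → T y - ζ ∈ I) ∧
    ∀ k, 1 ≤ k → ∀ y z, y - ζ ∈ I → z - ζ ∈ I → y - z ∈ I ^ k →
      T y - T z - c * (y - z) ∈ I ^ (k + 1)

namespace IsCongLinear

variable {R : Type*} [CommRing R] {I : Ideal R} {ζ c : R} {T : R → R}

theorem of_eval (f : R[X]) (hf : f.eval ζ = ζ) :
    IsCongLinear I ζ (f.derivative.eval ζ) (fun x => f.eval x) := by
  refine ⟨fun y hy => ?_, fun k hk y z _ hz hyz => ?_⟩
  · have h := Ideal.mem_of_dvd I (sub_dvd_eval_sub y ζ f) hy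
    rwa [hf] at h
  · obtain ⟨q, hq⟩ := f.binomExpansion z (y - z)
    have h1 : f.derivative.eval z - f.derivative.eval ζ ∈ I :=
      Ideal.mem_of_dvd I (sub_dvd_eval_sub z ζ f.derivative) hz
    have h2 : (f.derivative.eval z - f.derivative.eval ζ) * (y - z) ∈ I ^ (k + 1) := by
      rw [pow_succ']; exact Ideal.mul_mem_mul h1 hyz
    have h3 : (y - z) ^ 2 ∈ I ^ (k + 1) := by
      have := Ideal.pow_mem_pow hyz 2
      rw [← pow_mul] at this
      exact Ideal.pow_le_pow_right (by omega) this
    have h4 : f.eval y - f.eval z - f.derivative.eval ζ * (y - z) =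
        (f.derivative.eval z - f.derivative.eval ζ) * (y - z) + q * (y - z) ^ 2 := by
      rw [add_sub_cancel] at hq
      rw [hq]; ring
    simp only [h4]
    exact add_mem h2 (Ideal.mul_mem_left _ _ h3)

theorem sub_mem (h : IsCongLinear I ζ c T) {k : ℕ} (hk : 1 ≤ k) {y z : R} (hy : y - ζ ∈ I)
    (hz : z - ζ ∈ I) (hyz : y - z ∈ I ^ k) : T y - T z ∈ I ^ k := by
  have h1 := Ideal.pow_le_pow_right (Nat.le_succ k) (h.2 k hk y z hy hz hyz)
  have h2 := add_mem h1 (Ideal.mul_mem_left _ c hyz)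
  simpa using h2

theorem congr_multiplier (h : IsCongLinear I ζ c T) {c' : R} (hc : c - c' ∈ I) :
    IsCongLinear I ζ c' T := by
  refine ⟨h.1, fun k hk y z hy hz hyz => ?_⟩
  have h1 : (c - c') * (y - z) ∈ I ^ (k + 1) := by
    rw [pow_succ']; exact Ideal.mul_mem_mul hc hyz
  have h2 := add_mem (h.2 k hk y z hy hz hyz) h1
  convert h2 using 1
  ring

theorem iterate (h : IsCongLinear I ζ c T) (e : ℕ) : IsCongLinear I ζ (c ^ e) (T^[e]) := by
  induction e with
  | zero => exact ⟨fun y hy => by simpa using hy, fun k _ y z _ _ _ => by simp⟩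
  | succ e ih =>
    refine ⟨fun y hy => ?_, fun k hk y z hy hz hyz => ?_⟩
    · rw [Function.iterate_succ_apply']; exact h.1 _ (ih.1 y hy)
    · rw [Function.iterate_succ_apply', Function.iterate_succ_apply']
      have h1 := h.2 k hk _ _ (ih.1 y hy) (ih.1 z hz) (ih.sub_mem hk hy hz hyz)
      have h2 := add_mem h1 (Ideal.mul_mem_left _ c (ih.2 k hk y z hy hz hyz))
      convert h2 using 1
      ring

theorem iterate_sub_mem_succ (h : IsCongLinear I ζ 1 T) {p : ℕ} (hp : (p : R) ∈ I) {k : ℕ}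
    (hk : 1 ≤ k) {y : R} (hy : y - ζ ∈ I) (hT : T y - y ∈ I ^ k) :
    T^[p] y - y ∈ I ^ (k + 1) := by
  have key : ∀ t : ℕ, T^[t] y - ζ ∈ I ∧ T^[t] y - y ∈ I ^ k ∧
      T^[t] y - y - t * (T y - y) ∈ I ^ (k + 1) := by
    intro t
    induction t with
    | zero => simpa using hy
    | succ t ih =>
      obtain ⟨h1, h2, h3⟩ := ih
      rw [Function.iterate_succ_apply']
      have h4 := h.2 k hk _ _ h1 hy h2
      refine ⟨h.1 _ h1, ?_, ?_⟩
      · have := add_mem (h.sub_mem hk h1 hy h2) hT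
        simpa using this
      · have := add_mem h4 h3
        convert this using 1
        push_cast
        ring
  have h1 : (p : R) * (T y - y) ∈ I ^ (k + 1) := by
    rw [pow_succ']; exact Ideal.mul_mem_mul hp hT
  have := add_mem (key p).2.2 h1
  simpa using this

theorem iterate_pow_sub_mem (h : IsCongLinear I ζ 1 T) {p : ℕ} (hp : (p : R) ∈ I) (k : ℕ)
    {y : R} (hy : y - ζ ∈ I) : T^[p ^ k] y - y ∈ I ^ (k + 1) := by
  induction k with
  | zero =>
    have := _root_.sub_mem (h.1 y hy) hy
    simpa using this
  | succ k ih =>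
    rw [pow_succ p k, Function.iterate_mul]
    have h1 := h.iterate (p ^ k)
    rw [one_pow] at h1
    exact h1.iterate_sub_mem_succ hp (Nat.le_add_left 1 k) hy ih

end IsCongLinear

/-- A Noetherian local subring of `F` with fraction field `F` and residue field `ZMod p`. -/
structure RationalPlace (F : Type*) [Field F] (p : ℕ) where
  /-- The underlying local ring. -/
  ring : Subring F
  /-- The residue map. -/
  residue : ring →+* ZMod p
  noetherian : IsNoetherianRing ring
  inv_mem : ∀ x : ring, residue x ≠ 0 → (x : F)⁻¹ ∈ ring
  isFractionRing : IsFractionRing ring F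

namespace RationalPlace

variable {F : Type*} [Field F] {p : ℕ} [Fact p.Prime] (P : RationalPlace F p)

/-- The maximal ideal of a place. -/
def maxIdeal : Ideal P.ring := RingHom.ker P.residue

theorem mem_maxIdeal {x : P.ring} : x ∈ P.maxIdeal ↔ P.residue x = 0 := RingHom.mem_ker

theorem eq_zero_of_forall_mem_pow {x : P.ring} (hx : ∀ k : ℕ, x ∈ P.maxIdeal ^ k) : x = 0 := by
  have := P.noetherian
  have h := Ideal.iInf_pow_eq_bot_of_isDomain P.maxIdeal (RingHom.ker_ne_top P.residue)
  rw [← Ideal.mem_bot, ← h]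
  exact (Ideal.mem_iInf).2 hx

theorem natCast_mem_maxIdeal : (p : P.ring) ∈ P.maxIdeal := by
  rw [mem_maxIdeal, map_natCast, ZMod.natCast_self]

/-- The sequence `x` tends to infinity at the place `P`. -/
def Escapes (x : ℕ → F) : Prop :=
  ∀ m, ∃ y : P.ring, y ∈ P.maxIdeal ^ (m + 1) ∧ x m * y = 1

/-- The sequence `x` is integral and uniformly recurrent at the place `P`. -/
def Recurs (x : ℕ → F) : Prop :=
  ∃ w : ℕ → P.ring, (∀ m, x m = w m) ∧
    ∀ k m, w (m + (p - 1) * p ^ k) - w m ∈ P.maxIdeal ^ (k + 1)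

theorem exists_inv_eval (f : P.ring[X]) (hd : 2 ≤ f.natDegree)
    (hc : P.residue f.leadingCoeff ≠ 0) {k : ℕ} (hk : 1 ≤ k) {x : F} {y : P.ring}
    (hy : y ∈ P.maxIdeal ^ k) (hxy : x * y = 1) :
    ∃ y' : P.ring, y' ∈ P.maxIdeal ^ (k + 1) ∧ (f.map P.ring.subtype).eval x * y' = 1 := by
  set w := f.reverse.eval y with hw
  have hyI : y ∈ P.maxIdeal := Ideal.pow_le_self (by omega) hy
  have hwI : w - f.leadingCoeff ∈ P.maxIdeal := by
    have h := sub_dvd_eval_sub y 0 f.reverse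
    rw [sub_zero, ← coeff_zero_eq_eval_zero, coeff_zero_reverse] at h
    exact Ideal.mem_of_dvd _ h hyI
  have hres : P.residue w ≠ 0 := by
    rw [mem_maxIdeal, map_sub, sub_eq_zero] at hwI
    rwa [hwI]
  have hw0 : (w : F) ≠ 0 := by
    intro h
    have : w = 0 := Subtype.ext h
    exact hres (by rw [this, map_zero])
  refine ⟨y ^ f.natDegree * ⟨(w : F)⁻¹, P.inv_mem w hres⟩, ?_, ?_⟩
  · refine Ideal.mul_mem_right _ _ ?_
    have := Ideal.pow_mem_pow hy f.natDegree
    rw [← pow_mul] at this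
    exact Ideal.pow_le_pow_right (by nlinarith) this
  · have hx0 : x ≠ 0 := left_ne_zero_of_mul_eq_one hxy
    have hinv : x⁻¹ = (y : F) := inv_eq_of_mul_eq_one_right hxy
    let _ := invertibleOfNonzero hx0
    have h := eval₂_reverse_mul_pow P.ring.subtype x f
    rw [invOf_eq_inv, hinv, ← eval_map] at h
    have h2 : eval₂ P.ring.subtype (y : F) f.reverse = w := by
      rw [hw]
      exact eval₂_at_apply P.ring.subtype y
    rw [eval_map, h2] at h
    rw [eval_map, ← h]
    have h3 : x ^ f.natDegree * (y : F) ^ f.natDegree = 1 := by rw [← mul_pow, hxy, one_pow]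
    push_cast
    calc _ = (x ^ f.natDegree * (y : F) ^ f.natDegree) * (w * (w : F)⁻¹) := by ring
      _ = 1 := by rw [h3, mul_inv_cancel₀ hw0, one_mul]

theorem escapes_iterate (f : P.ring[X]) (hd : 2 ≤ f.natDegree)
    (hc : P.residue f.leadingCoeff ≠ 0) {a : F} {y : P.ring} (hy : y ∈ P.maxIdeal)
    (hay : a * y = 1) : P.Escapes fun m => (fun x => (f.map P.ring.subtype).eval x)^[m] a := by
  intro m
  induction m with
  | zero => exact ⟨y, by simpa using hy, hay⟩
  | succ m ih =>
    obtain ⟨z, hz, hz1⟩ := ih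
    simp only [Function.iterate_succ_apply']
    exact P.exists_inv_eval f hd hc (Nat.le_add_left 1 m) hz hz1

theorem recurs_iterate (f : P.ring[X]) {ζ a : P.ring} (hζ : f.eval ζ = ζ)
    (hf : P.residue (f.derivative.eval ζ) ≠ 0) (ha : a - ζ ∈ P.maxIdeal) :
    P.Recurs fun m => (fun x => (f.map P.ring.subtype).eval x)^[m] a := by
  have hT := IsCongLinear.of_eval (I := P.maxIdeal) f hζ
  refine ⟨fun m => (fun x => f.eval x)^[m] a, fun m => ?_, fun k m => ?_⟩
  · have hs : Function.Semiconj (P.ring.subtype) (fun x => f.eval x)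
        (fun x => (f.map P.ring.subtype).eval x) := fun x => by
      simp only [eval_map]
      exact (eval₂_at_apply P.ring.subtype x).symm
    exact ((hs.iterate_right m) a).symm
  · have h1 := (hT.iterate (p - 1)).congr_multiplier (c' := 1) (by
      rw [mem_maxIdeal, map_sub, map_pow, ZMod.pow_card_sub_one_eq_one hf, map_one, sub_self])
    have h2 := h1.iterate_pow_sub_mem P.natCast_mem_maxIdeal k ((hT.iterate m).1 a ha)
    rw [← Function.iterate_mul, ← Function.iterate_add_apply, add_comm _ m] at h2
    exact h2

theorem eval_sub_eval_mem {n : ℕ} {R : Type*} [CommRing R] (I : Ideal R)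
    (G : MvPolynomial (Fin n) R) {v w : Fin n → R} (h : ∀ j, v j - w j ∈ I) :
    MvPolynomial.eval v G - MvPolynomial.eval w G ∈ I := by
  have hq : (Ideal.Quotient.mk I ∘ v) = Ideal.Quotient.mk I ∘ w :=
    funext fun j => Ideal.Quotient.eq.2 (h j)
  have hc : ∀ z : Fin n → R, Ideal.Quotient.mk I (MvPolynomial.eval z G) =
      MvPolynomial.eval₂ (Ideal.Quotient.mk I) (Ideal.Quotient.mk I ∘ z) G := fun z =>
    MvPolynomial.eval₂_comp _ z G
  rw [← Ideal.Quotient.eq, hc, hc, hq]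

theorem eq_zero_of_map_eq_zero {n : ℕ} (u : ℕ → F) (v : Fin n → ℕ → F)
    (hu : P.Escapes u) (hv : ∀ j, P.Recurs (v j))
    (ih : ∀ G : MvPolynomial (Fin n) F,
      (∀ m, MvPolynomial.eval (fun j => v j m) G = 0) → G = 0)
    (G : MvPolynomial (Fin (n + 1)) P.ring)
    (hG : ∀ m, MvPolynomial.eval (Fin.cons (u m) fun j => v j m : Fin (n + 1) → F)
      (MvPolynomial.map P.ring.subtype G) = 0) : G = 0 := by
  choose y hy huy using hu
  choose w hw hrec using hv
  set Q := MvPolynomial.finSuccEquiv P.ring n G with hQ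
  have hval : ∀ m (H : MvPolynomial (Fin n) P.ring),
      MvPolynomial.eval (fun j => v j m) (MvPolynomial.map P.ring.subtype H) =
        (MvPolynomial.eval (fun j => w j m) H : P.ring) := by
    intro m H
    rw [MvPolynomial.eval_map, show (fun j => v j m) = fun j => P.ring.subtype (w j m) from
      funext fun j => hw j m]
    exact (MvPolynomial.eval₂_comp P.ring.subtype _ H).symm
  have hlead : ∀ m, MvPolynomial.eval (fun j => w j m) Q.leadingCoeff ∈ P.maxIdeal ^ (m + 1) := by
    intro m
    set q : P.ring[X] := Q.map (MvPolynomial.eval fun j => w j m) with hq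
    have hroot : eval₂ P.ring.subtype (u m) q = 0 := by
      have hhom : (eval₂RingHom P.ring.subtype (u m)).comp
            ((mapRingHom (MvPolynomial.eval fun j => w j m)).comp
              (MvPolynomial.finSuccEquiv P.ring n : _ →+* _)) =
          (MvPolynomial.eval (Fin.cons (u m) fun j => v j m : Fin (n + 1) → F)).comp
            (MvPolynomial.map P.ring.subtype) := by
        refine MvPolynomial.ringHom_ext (fun r => ?_) fun i => ?_
        · simp [MvPolynomial.finSuccEquiv_apply]
        · refine Fin.cases ?_ (fun i => ?_) i
          · simp [MvPolynomial.finSuccEquiv_X_zero]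
          · simp [MvPolynomial.finSuccEquiv_X_succ, hw]
      rw [← hG m]
      exact congrArg (fun φ => φ G) hhom
    have hu0 : u m ≠ 0 := left_ne_zero_of_mul_eq_one (huy m)
    have hinv : (u m)⁻¹ = (y m : F) := inv_eq_of_mul_eq_one_right (huy m)
    let _ := invertibleOfNonzero hu0
    have h := eval₂_reflect_mul_pow P.ring.subtype (u m) Q.natDegree q (natDegree_map_le)
    rw [hroot, invOf_eq_inv, hinv] at h
    have h2 := (mul_eq_zero.1 h).resolve_right (pow_ne_zero _ hu0)
    have h3 : (reflect Q.natDegree q).eval (y m) = 0 := by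
      have := eval₂_at_apply P.ring.subtype (p := reflect Q.natDegree q) (y m)
      exact Subtype.ext (this.symm.trans h2)
    have h4 := sub_dvd_eval_sub (y m) 0 (reflect Q.natDegree q)
    rw [sub_zero, h3, zero_sub, dvd_neg, ← coeff_zero_eq_eval_zero, coeff_reflect,
      revAt_le (Nat.zero_le _), Nat.sub_zero, hq, coeff_map] at h4
    exact Ideal.mem_of_dvd _ h4 (hy m)
  have hzero : ∀ m, MvPolynomial.eval (fun j => w j m) Q.leadingCoeff = 0 := by
    intro m
    refine P.eq_zero_of_forall_mem_pow fun k => ?_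
    have hp := (Fact.out : p.Prime).two_le
    have hk : k < p ^ k := Nat.lt_pow_self (by omega)
    have h1 : p ^ k ≤ (p - 1) * p ^ k := Nat.le_mul_of_pos_left _ (by omega)
    have h2 := Ideal.pow_le_pow_right (I := P.maxIdeal) (by omega)
      (hlead (m + (p - 1) * p ^ k)) (m := k)
    have h3 := eval_sub_eval_mem (P.maxIdeal ^ (k + 1)) Q.leadingCoeff fun j => hrec j k m
    have h4 := sub_mem h2 (Ideal.pow_le_pow_right (Nat.le_succ k) h3)
    simpa using h4
  have hQ0 : Q.leadingCoeff = 0 := by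
    refine MvPolynomial.map_injective P.ring.subtype Subtype.val_injective ?_
    rw [map_zero]
    refine ih _ fun m => ?_
    rw [hval, hzero]
    rfl
  rw [leadingCoeff_eq_zero, hQ] at hQ0
  exact (map_eq_zero_iff _ (MvPolynomial.finSuccEquiv P.ring n).injective).1 hQ0

theorem dense_cons {n : ℕ} (u : ℕ → F) (v : Fin n → ℕ → F)
    (hu : P.Escapes u) (hv : ∀ j, P.Recurs (v j))
    (ih : ∀ G : MvPolynomial (Fin n) F,
      (∀ m, MvPolynomial.eval (fun j => v j m) G = 0) → G = 0)
    (G : MvPolynomial (Fin (n + 1)) F)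
    (hG : ∀ m, MvPolynomial.eval (Fin.cons (u m) fun j => v j m : Fin (n + 1) → F) G = 0) :
    G = 0 := by
  have := P.isFractionRing
  obtain ⟨b, hb⟩ := IsLocalization.exist_integer_multiples_of_finset
    (nonZeroDivisors P.ring) (S := F) G.coeffs
  have hmem : MvPolynomial.C ((b : P.ring) : F) * G ∈
      Set.range (MvPolynomial.map (σ := Fin (n + 1)) P.ring.subtype) := by
    rw [MvPolynomial.mem_range_map_iff_coeffs_subset]
    intro c hc
    obtain ⟨d, hd, rfl⟩ := MvPolynomial.mem_coeffs_iff.1 (Finset.mem_coe.1 hc)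
    rw [MvPolynomial.mem_support_iff, MvPolynomial.coeff_C_mul] at hd
    obtain ⟨r, hr⟩ := hb _ (MvPolynomial.coeff_mem_coeffs d (right_ne_zero_of_mul hd))
    rw [MvPolynomial.coeff_C_mul]
    exact ⟨r, hr⟩
  obtain ⟨H, hH⟩ := hmem
  have hH0 : H = 0 := by
    refine P.eq_zero_of_map_eq_zero u v hu hv ih H fun m => ?_
    rw [hH, map_mul, hG, mul_zero]
  rw [hH0, map_zero] at hH
  exact (mul_eq_zero.1 hH.symm).resolve_left (by simp)

end RationalPlace

theorem eq_zero_of_escapes_of_recurs {F : Type*} [Field F] {n : ℕ} (x : Fin n → ℕ → F)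
    (H : ∀ i, ∃ p : ℕ, ∃ _ : Fact p.Prime, ∃ P : RationalPlace F p,
      P.Escapes (x i) ∧ ∀ j, j ≠ i → P.Recurs (x j))
    (G : MvPolynomial (Fin n) F) (hG : ∀ m, MvPolynomial.eval (fun j => x j m) G = 0) :
    G = 0 := by
  induction n with
  | zero =>
    rw [MvPolynomial.eq_C_of_isEmpty G] at hG ⊢
    simpa using hG 0
  | succ n ih =>
    obtain ⟨p, _, P, hu, hv⟩ := H 0
    refine P.dense_cons (x 0) (fun j => x j.succ) hu (fun j => hv _ (Fin.succ_ne_zero j))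
      (ih _ fun i => ?_) G fun m => ?_
    · obtain ⟨p, hp, P, hu, hv⟩ := H i.succ
      exact ⟨p, hp, P, hu, fun j hj => hv _ fun h => hj (Fin.succ_injective _ h)⟩
    · rw [← hG m]
      congr 2
      funext j
      refine Fin.cases rfl (fun j => rfl) j

universe u

theorem exists_prime_root_mod (h : ℤ[X]) (hd : h.natDegree ≠ 0) (M : ℕ) (hM : M ≠ 0) :
    ∃ p : ℕ, p.Prime ∧ ¬ p ∣ M ∧ ∃ r : ℤ, (p : ℤ) ∣ h.eval r := by
  by_cases hc : h.coeff 0 = 0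
  · obtain ⟨p, hpM, hp⟩ := Nat.exists_infinite_primes (M + 1)
    refine ⟨p, hp, fun hdvd => ?_, 0, ?_⟩
    · have := Nat.le_of_dvd (Nat.pos_of_ne_zero hM) hdvd
      omega
    · rw [← coeff_zero_eq_eval_zero, hc]
      exact dvd_zero _
  · set c := h.coeff 0 with hc'
    have hne : ∀ e : ℤ, h + C e ≠ 0 := fun e he => hd (by
      rw [← natDegree_add_C (a := e), he, natDegree_zero])
    have hprod : (h + C (-c)) * (h + C c) ≠ 0 := mul_ne_zero (hne _) (hne _)
    have hinj : Function.Injective fun t : ℤ => c * M * t :=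
      mul_right_injective₀ (mul_ne_zero hc (by exact_mod_cast hM))
    obtain ⟨t, ht⟩ : ∃ t : ℤ, ¬ IsRoot ((h + C (-c)) * (h + C c)) (c * M * t) := by
      by_contra! hall
      refine hprod (eq_zero_of_infinite_isRoot _
        ((Set.infinite_range_of_injective hinj).mono ?_))
      rintro _ ⟨t, rfl⟩
      exact hall t
    set e : ℤ := 1 + M * (t * h.divX.eval (c * M * t)) with he
    have heval : h.eval (c * M * t) = c * e := by
      conv_lhs => rw [← divX_mul_X_add h]
      rw [eval_add, eval_mul, eval_X, eval_C, ← hc', he]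
      ring
    have he1 : e.natAbs ≠ 1 := by
      intro h1
      apply ht
      rw [IsRoot, eval_mul, eval_add, eval_add, eval_C, eval_C, heval]
      rcases Int.natAbs_eq_iff.1 h1 with h2 | h2 <;> rw [h2] <;> push_cast <;> ring
    obtain ⟨p, hp, hpe⟩ := Nat.exists_prime_and_dvd he1
    have hpe' : (p : ℤ) ∣ e := Int.natCast_dvd.2 hpe
    refine ⟨p, hp, fun hpM => ?_, c * M * t, heval ▸ Dvd.dvd.mul_left hpe' c⟩
    have h1 : (p : ℤ) ∣ M * (t * h.divX.eval (c * M * t)) :=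
      Dvd.dvd.mul_right (Int.natCast_dvd_natCast.2 hpM) _
    have h2 : (p : ℤ) ∣ 1 := by
      have := dvd_sub hpe' h1
      rwa [he, add_sub_cancel_right] at this
    exact hp.one_lt.ne' (by exact_mod_cast Int.eq_one_of_dvd_one (by positivity) h2)

theorem exists_isIntegral_forall_mul_mem_adjoin (L : Type*) [Field L] [Algebra ℚ L]
    [Module.Finite ℚ L] (T : Finset L) :
    ∃ θ : L, IsIntegral ℤ θ ∧ ∃ N : ℕ, N ≠ 0 ∧
      ∀ s ∈ T, (N : L) * s ∈ Algebra.adjoin ℤ ({θ} : Set L) := by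
  have : CharZero L := algebraRat.charZero L
  obtain ⟨θ₀, hθ₀⟩ := Field.exists_primitive_element ℚ L
  obtain ⟨d, hd0, hd⟩ := ((IsFractionRing.isAlgebraic_iff ℤ ℚ L).2
    (Algebra.IsAlgebraic.isAlgebraic (R := ℚ) θ₀)).exists_integral_multiple
  have hmem : ∀ s : L, ∃ N : ℕ, N ≠ 0 ∧
      (N : L) * s ∈ Algebra.adjoin ℤ ({d • θ₀} : Set L) := by
    intro s
    have hs : s ∈ Algebra.adjoin ℚ ({θ₀} : Set L) := by
      rw [← IntermediateField.adjoin_simple_toSubalgebra_of_isAlgebraic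
        (Algebra.IsAlgebraic.isAlgebraic θ₀), hθ₀]
      exact Algebra.mem_top
    induction hs using Algebra.adjoin_induction with
    | mem x hx =>
      rw [Set.mem_singleton_iff.1 hx]
      refine ⟨d.natAbs, Int.natAbs_ne_zero.2 hd0, ?_⟩
      have h1 := Algebra.self_mem_adjoin_singleton ℤ (d • θ₀)
      have h2 : (d.natAbs : L) = d ∨ (d.natAbs : L) = -d := by
        rcases Int.natAbs_eq d with h | h
        · exact .inl (by rw [← Int.cast_natCast, ← h])
        · exact .inr (by
            rw [← Int.cast_natCast, ← Int.cast_neg,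
              eq_neg_of_add_eq_zero_left (a := (d.natAbs : ℤ)) (b := d) (by omega)])
      rcases h2 with h2 | h2
      · rwa [h2, ← zsmul_eq_mul]
      · rw [h2, neg_mul, ← zsmul_eq_mul]
        exact neg_mem h1
    | algebraMap q =>
      refine ⟨q.den, q.den_nz, ?_⟩
      have : (q.den : L) * algebraMap ℚ L q = (q.num : ℤ) := by
        rw [← map_natCast (algebraMap ℚ L), ← map_mul, mul_comm, Rat.mul_den_eq_num, map_intCast]
      rw [this]
      exact intCast_mem _ _
    | add x y _ _ hx hy =>
      obtain ⟨N₁, h1, h2⟩ := hx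
      obtain ⟨N₂, h3, h4⟩ := hy
      refine ⟨N₁ * N₂, mul_ne_zero h1 h3, ?_⟩
      have := add_mem (mul_mem (natCast_mem _ N₂) h2) (mul_mem (natCast_mem _ N₁) h4)
      convert this using 1
      push_cast
      ring
    | mul x y _ _ hx hy =>
      obtain ⟨N₁, h1, h2⟩ := hx
      obtain ⟨N₂, h3, h4⟩ := hy
      refine ⟨N₁ * N₂, mul_ne_zero h1 h3, ?_⟩
      have := mul_mem h2 h4
      convert this using 1
      push_cast
      ring
  choose N hN0 hN using hmem
  refine ⟨d • θ₀, hd, ∏ s ∈ T, N s, Finset.prod_ne_zero_iff.2 fun s _ => hN0 s, fun s hs => ?_⟩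
  obtain ⟨e, he⟩ := Finset.dvd_prod_of_mem N hs
  have := mul_mem (natCast_mem _ e) (hN s)
  rw [he]
  convert this using 1
  push_cast
  ring

theorem RationalPlace.exists_of_ringHom {F A : Type*} [Field F] [CommRing A] [IsNoetherianRing A]
    {p : ℕ} [Fact p.Prime] (i : A →+* F) (hi : Function.Injective i) (ρ : A →+* ZMod p)
    (hF : Subfield.closure (Set.range i) = ⊤) :
    ∃ P : RationalPlace F p, ∀ a, i a ∈ P.ring := by
  have : (RingHom.ker ρ).IsPrime := RingHom.ker_isPrime ρ
  have hunit : ∀ y : (RingHom.ker ρ).primeCompl, IsUnit (i y) := fun y => by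
    rw [isUnit_iff_ne_zero, map_ne_zero_iff i hi]
    intro h
    exact y.2 (by rw [h]; exact zero_mem _)
  have hunit' : ∀ y : (RingHom.ker ρ).primeCompl, IsUnit (ρ y) := fun y => by
    rw [isUnit_iff_ne_zero]
    exact y.2
  let B := Localization.AtPrime (RingHom.ker ρ)
  let j : B →+* F := IsLocalization.lift (M := (RingHom.ker ρ).primeCompl) hunit
  let σ : B →+* ZMod p := IsLocalization.lift (M := (RingHom.ker ρ).primeCompl) hunit'
  have hj : Function.Injective j := by
    refine (IsLocalization.lift_injective_iff hunit).2 fun x y => ?_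
    have : IsDomain A := hi.isDomain i
    rw [hi.eq_iff, (IsLocalization.injective B
      (RingHom.ker ρ).primeCompl_le_nonZeroDivisors).eq_iff]
  have hji : ∀ a, i a = j (algebraMap A B a) := fun a => (IsLocalization.lift_eq hunit a).symm
  let e : B ≃+* j.range := RingEquiv.ofBijective j.rangeRestrict
    ⟨fun x y h => hj (congrArg Subtype.val h), j.rangeRestrict_surjective⟩
  have hnoeth : IsNoetherianRing B :=
    IsLocalization.isNoetherianRing (RingHom.ker ρ).primeCompl B inferInstance
  refine ⟨⟨j.range, σ.comp e.symm.toRingHom, isNoetherianRing_of_ringEquiv B e, ?_, ?_⟩,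
    fun a => ⟨algebraMap A B a, (hji a).symm⟩⟩
  · intro x hx
    obtain ⟨b, rfl⟩ := e.surjective x
    have hb : σ b ≠ 0 := by simpa using hx
    obtain ⟨a, s, rfl⟩ := IsLocalization.exists_mk'_eq (RingHom.ker ρ).primeCompl b
    have ha : a ∈ (RingHom.ker ρ).primeCompl := by
      intro ha
      apply hb
      rw [IsLocalization.lift_mk', RingHom.mem_ker.1 ha, zero_mul]
    obtain ⟨u, hu⟩ := ((IsLocalization.AtPrime.isUnit_mk'_iff B (RingHom.ker ρ) a s).2 ha)
    refine ⟨(u⁻¹ : Bˣ), ?_⟩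
    refine eq_inv_of_mul_eq_one_left ?_
    change j _ * j _ = 1
    rw [← map_mul, ← hu, Units.inv_mul, map_one]
  · refine IsFractionRing.of_field _ _ fun z => ?_
    have hz : z ∈ Subfield.closure (Set.range i) := hF ▸ Subfield.mem_top z
    obtain ⟨x, hx, y, hy, rfl⟩ := Subfield.mem_closure_iff.1 hz
    rw [← RingHom.coe_range, Subring.closure_eq] at hx hy
    obtain ⟨a, rfl⟩ := hx
    obtain ⟨b, rfl⟩ := hy
    exact ⟨⟨i a, _, (hji a).symm⟩, ⟨i b, _, (hji b).symm⟩, rfl⟩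

theorem exists_ringHom_finite (k : Type*) (C : Type u) [Field k] [CommRing C] [Nontrivial C]
    [Algebra k C] [Algebra.FiniteType k C] :
    ∃ (L : Type u) (_ : Field L) (_ : Algebra k L) (_ : Module.Finite k L),
      Nonempty (C →+* L) := by
  obtain ⟨m, hm⟩ := Ideal.exists_maximal C
  let _ : Field (C ⧸ m) := Ideal.Quotient.field m
  have : Algebra.FiniteType k (C ⧸ m) :=
    Algebra.FiniteType.of_surjective (Ideal.Quotient.mkₐ k m) (Ideal.Quotient.mkₐ_surjective k m)
  exact ⟨C ⧸ m, inferInstance, inferInstance, finite_of_finite_type_of_isJacobsonRing k (C ⧸ m),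
    ⟨Ideal.Quotient.mk m⟩⟩

theorem RationalPlace.exists_of_finset {F : Type*} [Field F] [CharZero F] (S : Finset F)
    (hS : Subfield.closure (S : Set F) = ⊤) (M : ℕ) (hM : M ≠ 0) :
    ∃ p : ℕ, ∃ _ : Fact p.Prime, ¬ p ∣ M ∧ ∃ P : RationalPlace F p, ∀ s ∈ S, s ∈ P.ring := by
  classical
  let C := Algebra.adjoin ℚ (S : Set F)
  have hCfin : Algebra.FiniteType ℚ C :=
    (Subalgebra.fg_iff_finiteType _).1 (Subalgebra.fg_adjoin_finset S)
  obtain ⟨L, _, _, _, ⟨π⟩⟩ := exists_ringHom_finite ℚ C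
  have hL0 : CharZero L := algebraRat.charZero L
  let ι : S → C := fun s => ⟨s, Algebra.subset_adjoin s.2⟩
  let φ : C →ₐ[ℤ] L := π.toIntAlgHom
  obtain ⟨θ, hθ, N, hN0, hN⟩ := exists_isIntegral_forall_mul_mem_adjoin L
    (Finset.univ.image fun s : S => φ (ι s))
  obtain ⟨p, hp, hpMN, r, hr⟩ := exists_prime_root_mod (minpoly ℤ θ) (minpoly.natDegree_pos hθ).ne'
    (M * N) (mul_ne_zero hM hN0)
  have : Fact p.Prime := ⟨hp⟩
  refine ⟨p, this, fun h => hpMN (h.mul_right N), ?_⟩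
  let ρ₀ : Algebra.adjoin ℤ ({θ} : Set L) →+* ZMod p :=
    (AdjoinRoot.lift (Int.castRingHom (ZMod p)) (r : ZMod p) (by
      have := eval₂_at_apply (Int.castRingHom (ZMod p)) (p := minpoly ℤ θ) r
      simp only [eq_intCast] at this
      rw [this]
      exact (ZMod.intCast_zmod_eq_zero_iff_dvd _ _).2 hr)).comp
      (minpoly.equivAdjoin hθ).symm.toRingEquiv.toRingHom
  let T : Finset C := Finset.univ.image fun s : S => (N : C) * ι s
  let A := Algebra.adjoin ℤ (T : Set C)
  have hA : ∀ a : A, φ a ∈ Algebra.adjoin ℤ ({θ} : Set L) := by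
    intro a
    have h1 : A ≤ (Algebra.adjoin ℤ ({θ} : Set L)).comap φ := by
      refine Algebra.adjoin_le fun x hx => ?_
      obtain ⟨s, _, rfl⟩ := Finset.mem_image.1 (Finset.mem_coe.1 hx)
      have := hN (φ (ι s)) (Finset.mem_image_of_mem _ (Finset.mem_univ s))
      simpa using this
    exact h1 a.2
  have hAfin : Algebra.FiniteType ℤ A :=
    (Subalgebra.fg_iff_finiteType _).1 (Subalgebra.fg_adjoin_finset T)
  have hAn : IsNoetherianRing A := Algebra.FiniteType.isNoetherianRing ℤ A
  let ρ : A →+* ZMod p := ρ₀.comp ((φ.comp A.val).codRestrict _ hA).toRingHom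
  let i : A →+* F := C.val.toRingHom.comp A.val.toRingHom
  have hi : Function.Injective i := Subtype.val_injective.comp Subtype.val_injective
  have hiS : ∀ s ∈ S, ∃ a : A, i a = N * s := fun s hs =>
    ⟨⟨N * ι ⟨s, hs⟩, Algebra.subset_adjoin (Finset.mem_coe.2
      (Finset.mem_image_of_mem _ (Finset.mem_univ _)))⟩, by simp [i, ι]⟩
  have hNF : (N : F) ≠ 0 := by exact_mod_cast hN0
  obtain ⟨P, hP⟩ := RationalPlace.exists_of_ringHom i hi ρ (by
    rw [eq_top_iff, ← hS, Subfield.closure_le]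
    intro s hs
    obtain ⟨a, ha⟩ := hiS s hs
    have h1 : i a ∈ Subfield.closure (Set.range i) := Subfield.subset_closure ⟨a, rfl⟩
    have h2 := div_mem h1 (natCast_mem _ N)
    rwa [ha, mul_div_cancel_left₀ _ hNF] at h2)
  refine ⟨P, fun s hs => ?_⟩
  obtain ⟨a, ha⟩ := hiS s hs
  have h1 := P.inv_mem N (by
    rw [map_natCast, Ne, ZMod.natCast_eq_zero_iff]
    exact fun h => hpMN (h.mul_left M))
  have h2 := mul_mem h1 (hP a)
  rw [ha] at h2
  have h3 : (((N : P.ring) : F))⁻¹ * (N * s) = s := by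
    push_cast
    rw [inv_mul_cancel_left₀ hNF]
  rwa [h3] at h2

theorem exists_fixed_point_derivative_ne_zero {k : Type*} [Field k] [IsAlgClosed k] [CharZero k]
    (f : k[X]) (hf : 2 ≤ f.natDegree) : ∃ ζ, f.eval ζ = ζ ∧ f.derivative.eval ζ ≠ 0 := by
  by_contra! h
  have hdeg : (f - X).natDegree = f.natDegree :=
    natDegree_sub_eq_left_of_natDegree_lt (by rw [natDegree_X]; omega)
  have hg0 : f - X ≠ 0 := fun h0 => by
    rw [h0, natDegree_zero] at hdeg
    omega
  have hroot : ∀ ζ ∈ (f - X).roots, f.derivative.eval ζ = 0 := fun ζ hζ => h ζ (by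
    have := (mem_roots hg0).1 hζ
    rwa [IsRoot, eval_sub, eval_X, sub_eq_zero] at this)
  have hnodup : (f - X).roots.Nodup := by
    classical
    rw [Multiset.nodup_iff_count_le_one]
    intro ζ
    by_contra! hlt
    have hζ : ζ ∈ (f - X).roots := Multiset.count_pos.1 (by omega)
    rw [count_roots, one_lt_rootMultiplicity_iff_isRoot hg0] at hlt
    have := hlt.2
    rw [IsRoot, derivative_sub, derivative_X, eval_sub, hroot ζ hζ, eval_one] at this
    simp at this
  have hd0 : f.derivative ≠ 0 := fun h0 => by
    have := derivative_eq_zero.1 h0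
    omega
  have hle : (f - X).roots ≤ f.derivative.roots :=
    (Multiset.le_iff_subset hnodup).2 fun ζ hζ => (mem_roots hd0).2 (hroot ζ hζ)
  have h1 := Multiset.card_le_card hle
  have h2 := card_roots' f.derivative
  have h3 := natDegree_derivative_lt (p := f) (by omega)
  rw [← (IsAlgClosed.splits (f - X)).natDegree_eq_card_roots, hdeg] at h1
  omega

theorem RationalPlace.exists_map_eq {F : Type*} [Field F] {p : ℕ} (P : RationalPlace F p)
    (f : F[X]) (hf : ∀ k, f.coeff k ∈ P.ring) : ∃ g : P.ring[X], g.map P.ring.subtype = f :=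
  (lifts_iff_coeff_lifts f).2 fun k => ⟨⟨_, hf k⟩, rfl⟩

theorem RationalPlace.residue_ne_zero {F : Type*} [Field F] {p : ℕ} [Fact p.Prime]
    (P : RationalPlace F p) {x : P.ring} (hx : x ≠ 0) (hx' : (x : F)⁻¹ ∈ P.ring) :
    P.residue x ≠ 0 := by
  have h : x * ⟨_, hx'⟩ = 1 := Subtype.ext (mul_inv_cancel₀ fun h => hx (Subtype.ext h))
  have h1 := congrArg P.residue h
  rw [map_mul, map_one] at h1
  exact left_ne_zero_of_mul_eq_one h1

theorem exists_rat_of_primes {n : ℕ} (p : Fin n → ℕ) [∀ i, Fact (p i).Prime]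
    (hp : Function.Injective p) (c : ∀ i, Fin n → ZMod (p i)) :
    ∃ b : Fin n → ℕ, ∀ i j, (b j : ZMod (p i)) = if i = j then 1 else p j * c i j := by
  have hb : ∀ j, ∃ b : ℕ, ∀ i, (b : ZMod (p i)) = if i = j then 1 else p j * c i j := by
    intro j
    obtain ⟨b, hb⟩ := Nat.chineseRemainderOfFinset
      (fun i => (if i = j then 1 else p j * c i j : ZMod (p i)).val) p Finset.univ
      (fun i _ => (Fact.out : (p i).Prime).ne_zero)
      (fun i _ k _ hik => (Nat.coprime_primes Fact.out Fact.out).2 (hp.ne hik))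
    refine ⟨b, fun i => ?_⟩
    have := (ZMod.natCast_eq_natCast_iff _ _ _).2 (hb i (Finset.mem_univ i))
    rwa [ZMod.natCast_zmod_val] at this
  choose b hb using hb
  exact ⟨b, fun i j => hb j i⟩

theorem exists_injective_places {F : Type*} [Field F] [CharZero F] (S : Finset F)
    (hS : Subfield.closure (S : Set F) = ⊤) :
    ∃ p : ℕ → ℕ, Function.Injective p ∧
      ∀ i, ∃ _ : Fact (p i).Prime, ∃ P : RationalPlace F (p i), ∀ s ∈ S, s ∈ P.ring := by
  have hinf : {p : ℕ | ∃ _ : Fact p.Prime, ∃ P : RationalPlace F p,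
      ∀ s ∈ S, s ∈ P.ring}.Infinite := by
    refine Set.infinite_of_forall_exists_gt fun N => ?_
    obtain ⟨p, hp, hpN, P, hP⟩ := RationalPlace.exists_of_finset S hS N.factorial
      N.factorial_ne_zero
    exact ⟨p, ⟨hp, P, hP⟩, not_le.1 fun h => hpN (Nat.dvd_factorial hp.out.pos h)⟩
  exact ⟨fun i => hinf.natEmbedding _ i, fun i j h => (hinf.natEmbedding _).injective
    (Subtype.ext h), fun i => (hinf.natEmbedding _ i).2⟩

theorem exists_rat_dense_orbit {F : Type*} [Field F] [CharZero F] (S₀ : Finset F)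
    (hS₀ : Subfield.closure (S₀ : Set F) = ⊤) {n : ℕ} (f : Fin n → F[X])
    (hf : ∀ i, 2 ≤ (f i).natDegree) (ζ : Fin n → F) (hζ : ∀ i, (f i).eval (ζ i) = ζ i)
    (hζ' : ∀ i, (f i).derivative.eval (ζ i) ≠ 0) :
    ∃ a : Fin n → ℚ, ∀ G : MvPolynomial (Fin n) F,
      (∀ m : ℕ, MvPolynomial.eval (fun i => (fun x => (f i).eval x)^[m] (a i : F)) G = 0) →
        G = 0 := by
  classical
  let S : Finset F := S₀ ∪ Finset.univ.biUnion fun j =>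
    (f j).coeffs ∪ {(f j).leadingCoeff⁻¹, ζ j, ((f j).derivative.eval (ζ j))⁻¹}
  have hS : Subfield.closure (S : Set F) = ⊤ := by
    rw [eq_top_iff, ← hS₀]
    exact Subfield.closure_mono (Finset.coe_subset.2 Finset.subset_union_left)
  have hSj : ∀ j, ∀ x ∈ (f j).coeffs ∪
      {(f j).leadingCoeff⁻¹, ζ j, ((f j).derivative.eval (ζ j))⁻¹}, x ∈ S := fun j x hx =>
    Finset.mem_union_right _ (Finset.mem_biUnion.2 ⟨j, Finset.mem_univ j, hx⟩)
  obtain ⟨q, hq, hP⟩ := exists_injective_places S hS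
  choose hprime P hPS using fun i : Fin n => hP i
  let p : Fin n → ℕ := fun i => q i
  have hp : Function.Injective p := hq.comp Fin.val_injective
  have hcoeff : ∀ i j k, (f j).coeff k ∈ (P i).ring := fun i j k => by
    by_cases h : (f j).coeff k = 0
    · rw [h]
      exact zero_mem _
    · exact hPS i _ (hSj j _ (Finset.mem_union_left _ (coeff_mem_coeffs h)))
  have hlc : ∀ i j, (f j).leadingCoeff⁻¹ ∈ (P i).ring := fun i j =>
    hPS i _ (hSj j _ (by simp))
  have hζP : ∀ i j, ζ j ∈ (P i).ring := fun i j => hPS i _ (hSj j _ (by simp))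
  have hder : ∀ i j, ((f j).derivative.eval (ζ j))⁻¹ ∈ (P i).ring := fun i j =>
    hPS i _ (hSj j _ (by simp))
  choose g hg using fun i j => (P i).exists_map_eq (f j) (hcoeff i j)
  obtain ⟨b, hb⟩ := exists_rat_of_primes p hp fun i j => (P i).residue ⟨ζ j, hζP i j⟩
  refine ⟨fun j => b j / p j, fun G hG => eq_zero_of_escapes_of_recurs _ (fun i => ?_) G hG⟩
  have hinj : Function.Injective (P i).ring.subtype := Subtype.val_injective
  have hpF : ∀ j, (p j : F) ≠ 0 := fun j => by exact_mod_cast (hprime j).out.ne_zero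
  refine ⟨p i, hprime i, P i, ?_, fun j hji => ?_⟩
  · have hbi : (P i).residue (b i) ≠ 0 := by
      rw [map_natCast, hb i i, if_pos rfl]
      exact one_ne_zero
    have hb0 : (b i : F) ≠ 0 := by
      intro h
      apply hbi
      have : ((b i : (P i).ring)) = 0 := Subtype.ext (by simpa using h)
      rw [this, map_zero]
    have := (P i).escapes_iterate (g i i) (by
        rw [← natDegree_map_eq_of_injective hinj, hg]; exact hf i) (by
        have h1 : ((g i i).leadingCoeff : F) = (f i).leadingCoeff := by
          rw [← hg i i, leadingCoeff_map_of_injective hinj]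
          rfl
        refine (P i).residue_ne_zero (fun h => ?_) (by rw [h1]; exact hlc i i)
        rw [h, ZeroMemClass.coe_zero, eq_comm, leadingCoeff_eq_zero] at h1
        have := hf i
        rw [h1, natDegree_zero] at this
        omega)
      (a := ((b i / p i : ℚ) : F)) (y := (p i : (P i).ring) * ⟨_, (P i).inv_mem _ hbi⟩)
      (Ideal.mul_mem_right _ _ (P i).natCast_mem_maxIdeal) (by
        push_cast
        have := hpF i
        field_simp)
    rwa [hg] at this
  · have hpj : (P i).residue (p j) ≠ 0 := by
      rw [map_natCast, Ne, ZMod.natCast_eq_zero_iff, Nat.prime_dvd_prime_iff_eq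
        (hprime i).out (hprime j).out]
      exact fun h => hji (hp h).symm
    let a : (P i).ring := b j * ⟨_, (P i).inv_mem _ hpj⟩
    have ha : ((b j / p j : ℚ) : F) = a := by
      push_cast [a]
      rw [div_eq_mul_inv]
    have hpa : (p j : (P i).ring) * a = b j := Subtype.ext (by
      rw [Subring.coe_mul, ← ha]
      push_cast
      exact mul_div_cancel₀ _ (hpF j))
    have hζg : (g i j).eval ⟨ζ j, hζP i j⟩ = ⟨ζ j, hζP i j⟩ := by
      apply hinj
      rw [← eval₂_at_apply, ← eval_map, hg]
      exact hζ j
    have hdg : (((g i j).derivative.eval ⟨ζ j, hζP i j⟩ : (P i).ring) : F) =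
        (f j).derivative.eval (ζ j) := by
      rw [← hg i j, derivative_map, eval_map]
      exact (eval₂_at_apply (P i).ring.subtype _).symm
    have := (P i).recurs_iterate (g i j) (a := a) hζg
      ((P i).residue_ne_zero (fun h => hζ' j (by rw [← hdg, h]; rfl)) (by
        rw [hdg]; exact hder i j)) (by
      rw [RationalPlace.mem_maxIdeal, map_sub, sub_eq_zero]
      refine mul_left_cancel₀ hpj ?_
      rw [← map_mul, hpa, map_natCast, hb i j, if_neg (Ne.symm hji), map_natCast])
    rwa [hg, ← ha] at this

theorem exists_ringHom_fg_field {K : Type u} [Field K] [CharZero K] {n : ℕ} (f : Fin n → K[X])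
    (hf : ∀ i, 2 ≤ (f i).natDegree) :
    ∃ (E : Type u) (_ : Field E) (σ : K →+* E) (F : Subfield E) (S : Finset F)
      (g : Fin n → F[X]) (ζ : Fin n → F), Subfield.closure (S : Set F) = ⊤ ∧
      (∀ i, (g i).map F.subtype = (f i).map σ) ∧ (∀ i, (g i).eval (ζ i) = ζ i) ∧
      ∀ i, (g i).derivative.eval (ζ i) ≠ 0 := by
  classical
  let E := AlgebraicClosure K
  let σ : K →+* E := algebraMap K E
  have : CharZero E := charZero_of_injective_algebraMap σ.injective
  choose ζ hζ hζ' using fun i => exists_fixed_point_derivative_ne_zero ((f i).map σ)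
    (by rw [natDegree_map]; exact hf i)
  let T : Finset E := Finset.univ.biUnion fun j => insert (ζ j) ((f j).map σ).coeffs
  let F := Subfield.closure (T : Set E)
  have hT : ∀ j, ∀ x ∈ insert (ζ j) ((f j).map σ).coeffs, x ∈ F := fun j x hx =>
    Subfield.subset_closure (Finset.mem_coe.2 (Finset.mem_biUnion.2 ⟨j, Finset.mem_univ j, hx⟩))
  have hcoeff : ∀ j k, ((f j).map σ).coeff k ∈ F := fun j k => by
    by_cases h : ((f j).map σ).coeff k = 0
    · rw [h]
      exact zero_mem _
    · exact hT j _ (Finset.mem_insert_of_mem (coeff_mem_coeffs h))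
  choose g hg using fun j => (lifts_iff_coeff_lifts (f := F.subtype) ((f j).map σ)).2
    fun k => ⟨Subtype.mk _ (hcoeff j k), rfl⟩
  replace hg : ∀ i, (g i).map F.subtype = (f i).map σ := hg
  let z : Fin n → F := fun j => Subtype.mk (ζ j) (hT j _ (Finset.mem_insert_self _ _))
  refine ⟨E, inferInstance, σ, F, T.preimage F.subtype F.subtype.injective.injOn, g, z,
    ?_, hg, fun i => ?_, fun i h => hζ' i ?_⟩
  · refine eq_top_iff.2 fun x _ => ?_
    rw [Finset.coe_preimage]
    have hle : F ≤ (Subfield.closure (F.subtype ⁻¹' (T : Set E))).map F.subtype :=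
      Subfield.closure_le.2 fun y hy =>
        ⟨Subtype.mk y (Subfield.subset_closure hy), Subfield.subset_closure hy, rfl⟩
    obtain ⟨y, hy, hyx⟩ := hle x.2
    rwa [← F.subtype.injective hyx]
  · apply F.subtype.injective
    rw [← eval₂_at_apply, ← eval_map, hg]
    exact hζ i
  · rw [← hg, derivative_map, eval_map]
    change eval₂ F.subtype (F.subtype (z i)) _ = 0
    rw [eval₂_at_apply, h, map_zero]

theorem MvPolynomial.eq_zero_of_subfield {n : ℕ} {E : Type*} [Field E] (F : Subfield E)
    (x : ℕ → Fin n → F)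
    (hx : ∀ G : MvPolynomial (Fin n) F, (∀ m, MvPolynomial.eval (x m) G = 0) → G = 0)
    (G : MvPolynomial (Fin n) E) (hG : ∀ m, MvPolynomial.eval (fun i => (x m i : E)) G = 0) :
    G = 0 := by
  ext d
  rw [MvPolynomial.coeff_zero]
  by_contra hd
  obtain ⟨l, hl⟩ := not_forall.1 (mt (Module.forall_dual_apply_eq_zero_iff F _).1 hd)
  have h0 := hx (∑ e ∈ G.support, MvPolynomial.monomial e (l (G.coeff e))) fun m => by
    rw [← map_zero l, ← hG m, map_sum, MvPolynomial.eval_eq', map_sum]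
    refine Finset.sum_congr rfl fun e _ => ?_
    have h : G.coeff e * ∏ i, (x m i : E) ^ e i = (∏ i, x m i ^ e i) • G.coeff e := by
      rw [Subfield.smul_def, smul_eq_mul, mul_comm]
      push_cast
      rfl
    rw [h, map_smul, MvPolynomial.eval_monomial, Finsupp.prod_fintype _ _ (by simp), smul_eq_mul,
      mul_comm]
  apply hl
  have := congrArg (MvPolynomial.coeff d) h0
  simpa [MvPolynomial.coeff_sum, MvPolynomial.coeff_monomial, hd] using this

/-- **Density of dynamical orbits (Zhang's conjecture for coordinatewise polynomials).**
Over a field `K` of characteristic zero, if `f₁, …, f_n` each have degree at least 2,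
then the coordinatewise dynamical system `Φ(x₁,…,x_n) = (f₁(x₁),…,f_n(x_n))` has a
point with Zariski dense forward orbit: the only polynomial vanishing at all
iterates is zero. -/
theorem zhang_dense_orbit (K : Type*) [Field K] [CharZero K]
    (n : ℕ) (f : Fin n → Polynomial K) (hf : ∀ i, 2 ≤ (f i).natDegree) :
    ∃ a : Fin n → K,
      ∀ G : MvPolynomial (Fin n) K,
        (∀ m : ℕ, MvPolynomial.eval
            (fun i => (fun x : K => (f i).eval x)^[m] (a i)) G = 0) → G = 0 := by
  obtain ⟨E, _, σ, F, S, g, ζ, hS, hg, hζ, hζ'⟩ := exists_ringHom_fg_field f hf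
  have : CharZero E := charZero_of_injective_ringHom σ.injective
  have hdeg : ∀ i, 2 ≤ (g i).natDegree := fun i => by
    rw [← natDegree_map F.subtype, hg, natDegree_map]
    exact hf i
  obtain ⟨a, ha⟩ := exists_rat_dense_orbit S hS g hdeg ζ hζ hζ'
  refine ⟨fun i => a i, fun G hG => MvPolynomial.map_injective σ σ.injective ?_⟩
  rw [map_zero]
  refine MvPolynomial.eq_zero_of_subfield F _ ha _ fun m => ?_
  have horbit : (fun i => F.subtype ((fun x => (g i).eval x)^[m] (a i : F))) =
      fun i => σ ((fun x => (f i).eval x)^[m] (a i : K)) := by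
    funext i
    have h1 : Function.Semiconj F.subtype (fun x => (g i).eval x)
        (fun x => ((f i).map σ).eval x) := fun x => by
      change F.subtype ((g i).eval x) = ((f i).map σ).eval (F.subtype x)
      rw [← hg, eval_map, eval₂_at_apply]
    have h2 : Function.Semiconj σ (fun x => (f i).eval x)
        (fun x => ((f i).map σ).eval x) := fun x => by
      change σ ((f i).eval x) = ((f i).map σ).eval (σ x)
      rw [eval_map, eval₂_at_apply]
    rw [(h1.iterate_right m).eq, (h2.iterate_right m).eq, map_ratCast, map_ratCast]
  change MvPolynomial.eval (fun i => F.subtype _) _ = 0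
  rw [horbit, MvPolynomial.eval_map]
  have := MvPolynomial.eval₂_comp σ (fun i => (fun x => (f i).eval x)^[m] (a i : K)) G
  rw [hG m, map_zero] at this
  exact this.symm
end

section
/- Let K be a field of characteristic zero and let N_1, …, N_n be integers each at least 2. Then there exists a point a = (a_1, …, a_n) with each a_i ∈ K^× such that the forward orbit of a under the map (x_1, …, x_n) ↦ (x_1^{N_1}, …, x_n^{N_n}) is Zariski dense in affine n-space; that is, the only polynomial G ∈ K[x_1, …, x_n] satisfying G(a_1^{N_1^m}, …, a_n^{N_n^m}) = 0 for every m ∈ ℕ is the zero polynomial. -/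
open Filter Topology in
/-- A nontrivial combination of exponential sequences `k ^ m` with integer bases `k ≥ 2` tends
to `+∞` or to `-∞`. -/
theorem tendsto_sum_mul_pow_atTop_or_atBot (c : ℕ → ℝ) (T : Finset ℕ) :
    (∀ k ∈ T, 2 ≤ k) → (∃ k ∈ T, c k ≠ 0) →
      Tendsto (fun m : ℕ => ∑ k ∈ T, c k * (k : ℝ) ^ m) atTop atTop ∨
      Tendsto (fun m : ℕ => ∑ k ∈ T, c k * (k : ℝ) ^ m) atTop atBot := by
  induction T using Finset.induction_on_max with
  | empty => simp
  | insert M s hM ih =>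
    intro h2 hne
    have hMs : M ∉ s := fun h => lt_irrefl _ (hM M h)
    by_cases hc : c M = 0
    · have := ih (fun k hk => h2 k (Finset.mem_insert_of_mem hk)) (by
        obtain ⟨k, hk, hk0⟩ := hne
        rcases Finset.mem_insert.1 hk with rfl | hk
        · exact absurd hc hk0
        · exact ⟨k, hk, hk0⟩)
      simpa [Finset.sum_insert hMs, hc] using this
    · have hM2 : 2 ≤ M := h2 M (Finset.mem_insert_self _ _)
      have hM0 : (0 : ℝ) < M := by exact_mod_cast (by omega : 0 < M)
      have hpow : Tendsto (fun m : ℕ => (M : ℝ) ^ m) atTop atTop :=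
        tendsto_pow_atTop_atTop_of_one_lt (by exact_mod_cast (by omega : 1 < M))
      have hlim : Tendsto (fun m : ℕ => c M + ∑ k ∈ s, c k * ((k : ℝ) / M) ^ m) atTop
          (𝓝 (c M)) := by
        have : Tendsto (fun m : ℕ => ∑ k ∈ s, c k * ((k : ℝ) / M) ^ m) atTop
            (𝓝 (∑ k ∈ s, c k * 0)) := by
          refine tendsto_finsetSum _ fun k hk => Tendsto.const_mul _ ?_
          refine tendsto_pow_atTop_nhds_zero_of_lt_one (by positivity) ?_
          rw [div_lt_one hM0]
          exact_mod_cast hM k hk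
        simpa using this.const_add (c M)
      have heq : (fun m : ℕ => ∑ k ∈ insert M s, c k * (k : ℝ) ^ m) =
          fun m : ℕ => (M : ℝ) ^ m * (c M + ∑ k ∈ s, c k * ((k : ℝ) / M) ^ m) := by
        funext m
        rw [Finset.sum_insert hMs, mul_add, Finset.mul_sum, mul_comm]
        congr 1
        refine Finset.sum_congr rfl fun k _ => ?_
        rw [div_pow]
        field_simp
      rw [heq]
      rcases lt_or_gt_of_ne hc with h | h
      · exact Or.inr (hpow.atTop_mul_neg h hlim)
      · exact Or.inl (hpow.atTop_mul_pos h hlim)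

/-- A transitive relation that is total on distinct elements has a greatest element on every
nonempty finite set. -/
theorem Finset.exists_forall_ne_rel {ι : Type*} (r : ι → ι → Prop)
    (htrans : ∀ a b c, r a b → r b c → r a c) (htot : ∀ a b, a ≠ b → r a b ∨ r b a)
    (S : Finset ι) (hS : S.Nonempty) : ∃ a ∈ S, ∀ b ∈ S, b ≠ a → r a b := by
  classical
  induction hS using Finset.Nonempty.cons_induction with
  | singleton a => exact ⟨a, by simp, by simp⟩
  | cons x s hx hs ih =>
    obtain ⟨a, ha, hmax⟩ := ih
    have hxa : x ≠ a := fun h => hx (h ▸ ha)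
    rcases htot x a hxa with h | h
    · refine ⟨x, by simp, fun b hb hbx => ?_⟩
      have hb : b ∈ s := (Finset.mem_cons.1 hb).resolve_left hbx
      by_cases hba : b = a
      · exact hba ▸ h
      · exact htrans _ _ _ h (hmax b hb hba)
    · refine ⟨a, by simp [ha], fun b hb hba => ?_⟩
      rcases Finset.mem_cons.1 hb with rfl | hb
      · exact h
      · exact hmax b hb hba

open Filter Topology in
/-- In a vanishing linear combination of exponentials, the coefficient of a term dominating all
others is zero. -/
theorem eq_zero_of_sum_mul_exp_eq_zero {ι : Type*} (S : Finset ι) (c : ι → ℝ)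
    (E : ι → ℕ → ℝ) (a : ι) (ha : a ∈ S)
    (hdom : ∀ b ∈ S, b ≠ a → Tendsto (fun m => E a m - E b m) atTop atTop)
    (hsum : ∀ m, ∑ b ∈ S, c b * Real.exp (E b m) = 0) : c a = 0 := by
  classical
  have hlim : Tendsto (fun m => ∑ b ∈ S, c b * Real.exp (-(E a m - E b m))) atTop
      (𝓝 (∑ b ∈ S, if b = a then c b else 0)) := by
    refine tendsto_finsetSum _ fun b hb => ?_
    by_cases hba : b = a
    · subst hba
      simp
    · simpa [hba] using
        (Real.tendsto_exp_neg_atTop_nhds_zero.comp (hdom b hb hba)).const_mul (c b)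
  have hzero : (fun m => ∑ b ∈ S, c b * Real.exp (-(E a m - E b m))) = fun _ => 0 := by
    funext m
    have h : ∑ b ∈ S, c b * Real.exp (-(E a m - E b m)) =
        Real.exp (-E a m) * ∑ b ∈ S, c b * Real.exp (E b m) := by
      rw [Finset.mul_sum]
      refine Finset.sum_congr rfl fun b _ => ?_
      rw [neg_sub, sub_eq_add_neg, Real.exp_add]
      ring
    rw [h, hsum, mul_zero]
  rw [hzero, Finset.sum_ite_eq' S a, if_pos ha] at hlim
  exact tendsto_nhds_unique hlim tendsto_const_nhds

/-- Logarithms of distinct primes are linearly independent over the natural numbers. -/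
theorem eq_of_sum_mul_log_prime_eq {ι : Type*} (p : ι → ℕ) (hp : ∀ i, (p i).Prime)
    (hinj : Function.Injective p) (T : Finset ι) (α β : ι → ℕ)
    (h : ∑ i ∈ T, (α i : ℝ) * Real.log (p i) = ∑ i ∈ T, (β i : ℝ) * Real.log (p i)) :
    ∀ i ∈ T, α i = β i := by
  classical
  have hlog : ∀ γ : ι → ℕ, ∑ i ∈ T, (γ i : ℝ) * Real.log (p i) =
      Real.log ((∏ i ∈ T, p i ^ γ i : ℕ) : ℝ) := by
    intro γ
    push_cast
    rw [Real.log_prod fun i _ => pow_ne_zero _ (Nat.cast_ne_zero.2 (hp i).ne_zero)]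
    simp [Real.log_pow]
  have hpos : ∀ γ : ι → ℕ, 0 < ∏ i ∈ T, p i ^ γ i := fun γ =>
    Finset.prod_pos fun i _ => pow_pos (hp i).pos _
  have hprod : ∏ i ∈ T, p i ^ α i = ∏ i ∈ T, p i ^ β i := by
    rw [hlog, hlog] at h
    exact_mod_cast Real.log_injOn_pos (Set.mem_Ioi.2 (Nat.cast_pos.2 (hpos α)))
      (Set.mem_Ioi.2 (Nat.cast_pos.2 (hpos β))) h
  have hfac : ∀ γ : ι → ℕ, ∀ j ∈ T, (∏ i ∈ T, p i ^ γ i).factorization (p j) = γ j := by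
    intro γ j hj
    rw [Nat.factorization_prod fun i _ => pow_ne_zero _ (hp i).ne_zero, Finsupp.finsetSum_apply,
      Finset.sum_eq_single j]
    · simp [(hp j).factorization]
    · intro i _ hij
      simp [(hp i).factorization, hinj.ne hij]
    · exact fun h => absurd hj h
  intro j hj
  rw [← hfac α j hj, hprod, hfac β j hj]

open Filter Topology in
/-- Logarithms of distinct monomials along the orbit of a point with distinct prime coordinates
diverge from each other. -/
theorem tendsto_sub_sum_log_prime_mul_pow {ι : Type*} [Fintype ι] (p : ι → ℕ)
    (hp : ∀ i, (p i).Prime) (hinj : Function.Injective p) (N : ι → ℕ) (hN : ∀ i, 2 ≤ N i)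
    (α β : ι → ℕ) (hne : α ≠ β) :
    Tendsto (fun m : ℕ => ∑ i, (α i : ℝ) * Real.log (p i) * (N i : ℝ) ^ m -
      ∑ i, (β i : ℝ) * Real.log (p i) * (N i : ℝ) ^ m) atTop atTop ∨
    Tendsto (fun m : ℕ => ∑ i, (α i : ℝ) * Real.log (p i) * (N i : ℝ) ^ m -
      ∑ i, (β i : ℝ) * Real.log (p i) * (N i : ℝ) ^ m) atTop atBot := by
  classical
  let c : ℕ → ℝ := fun k => ∑ i with N i = k, (α i : ℝ) * Real.log (p i) -
    ∑ i with N i = k, (β i : ℝ) * Real.log (p i)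
  have key := tendsto_sum_mul_pow_atTop_or_atBot c (Finset.univ.image N)
    (by simpa using hN) (by
      by_contra! hc
      refine hne (funext fun i => ?_)
      exact eq_of_sum_mul_log_prime_eq p hp hinj _ α β
        (sub_eq_zero.1 (hc (N i) (Finset.mem_image_of_mem N (Finset.mem_univ i)))) i (by simp))
  have heq : ∀ m : ℕ, ∑ k ∈ Finset.univ.image N, c k * (k : ℝ) ^ m =
      ∑ i, (α i : ℝ) * Real.log (p i) * (N i : ℝ) ^ m -
        ∑ i, (β i : ℝ) * Real.log (p i) * (N i : ℝ) ^ m := by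
    intro m
    have hgroup : ∀ γ : ι → ℕ, ∑ k ∈ Finset.univ.image N,
        (∑ i with N i = k, (γ i : ℝ) * Real.log (p i)) * (k : ℝ) ^ m =
        ∑ i, (γ i : ℝ) * Real.log (p i) * (N i : ℝ) ^ m := by
      intro γ
      rw [← Finset.sum_fiberwise_of_maps_to (g := N) (t := Finset.univ.image N)
        (fun i hi => Finset.mem_image_of_mem N hi)]
      refine Finset.sum_congr rfl fun k _ => ?_
      rw [Finset.sum_mul]
      refine Finset.sum_congr rfl fun i hi => ?_
      rw [(Finset.mem_filter.1 hi).2]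
    simp only [c, sub_mul, Finset.sum_sub_distrib, hgroup]
  simpa only [heq] using key

/-- **Dense orbits for coordinatewise power maps.**  Over a field `K` of characteristic
zero, for integers `N₁, …, N_n ≥ 2` there is a point `a` with all coordinates nonzero
whose forward orbit under `(x₁, …, x_n) ↦ (x₁^{N₁}, …, x_n^{N_n})` is Zariski dense:
the only polynomial vanishing at `(a₁^{N₁^m}, …, a_n^{N_n^m})` for all `m` is zero. -/
theorem power_map_dense_orbit (K : Type*) [Field K] [CharZero K]
    (n : ℕ) (N : Fin n → ℕ) (hN : ∀ i, 2 ≤ N i) :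
    ∃ a : Fin n → K, (∀ i, a i ≠ 0) ∧
      ∀ G : MvPolynomial (Fin n) K,
        (∀ m : ℕ, MvPolynomial.eval (fun i => a i ^ (N i ^ m)) G = 0) → G = 0 := by
  let p : Fin n → ℕ := fun i => Nat.nth Nat.Prime i
  have hp : ∀ i, (p i).Prime := fun i => Nat.prime_nth_prime i
  have hinj : Function.Injective p := fun i j h =>
    Fin.ext (Nat.nth_injective Nat.infinite_setOfPred_prime h)
  refine ⟨fun i => (p i : K), fun i => Nat.cast_ne_zero.2 (hp i).ne_zero, fun G hG => ?_⟩
  by_contra hG0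
  let E : (Fin n →₀ ℕ) → ℕ → ℝ := fun d m => ∑ i, (d i : ℝ) * Real.log (p i) * (N i : ℝ) ^ m
  obtain ⟨d, hd, hdom⟩ := Finset.exists_forall_ne_rel
    (fun a b => Filter.Tendsto (fun m => E a m - E b m) Filter.atTop Filter.atTop)
    (fun a b c hab hbc => by simpa using hab.atTop_add_atTop hbc)
    (fun a b hab => by
      refine (tendsto_sub_sum_log_prime_mul_pow p hp hinj N hN a b
        (fun h => hab (DFunLike.coe_injective h))).imp id fun h => ?_
      simpa [E, Function.comp_def] using Filter.tendsto_neg_atBot_atTop.comp h)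
    G.support (MvPolynomial.support_nonempty.2 hG0)
  -- A rational functional detecting the dominant coefficient reduces to rational coefficients.
  obtain ⟨φ, hφ⟩ : ∃ φ : Module.Dual ℚ K, φ (G.coeff d) ≠ 0 := by
    by_contra! h
    exact MvPolynomial.mem_support_iff.1 hd ((Module.forall_dual_apply_eq_zero_iff ℚ _).1 h)
  refine hφ ?_
  have hexp : ∀ b m, Real.exp (E b m) = ((∏ i, (p i ^ (N i ^ m)) ^ b i : ℕ) : ℝ) := by
    intro b m
    push_cast
    rw [Real.exp_sum]
    refine Finset.prod_congr rfl fun i _ => ?_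
    have hpi : (0 : ℝ) < p i := Nat.cast_pos.2 (hp i).pos
    rw [← Real.exp_log (pow_pos (pow_pos hpi _) _), Real.log_pow, Real.log_pow]
    push_cast
    ring_nf
  have hzero := eq_zero_of_sum_mul_exp_eq_zero G.support (fun b => (φ (G.coeff b) : ℝ)) E d hd hdom
    (fun m => by
      have h := congrArg φ (hG m)
      rw [MvPolynomial.eval_eq', map_sum, map_zero] at h
      have hterm : ∀ b, φ (G.coeff b * ∏ i, ((p i : K) ^ (N i ^ m)) ^ b i) =
          φ (G.coeff b) * ((∏ i, (p i ^ (N i ^ m)) ^ b i : ℕ) : ℚ) := by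
        intro b
        have hcast : G.coeff b * ∏ i, ((p i : K) ^ (N i ^ m)) ^ b i =
            (∏ i, (p i ^ (N i ^ m)) ^ b i) • G.coeff b := by
          rw [nsmul_eq_mul, mul_comm]
          push_cast
          rfl
        rw [hcast, map_nsmul, nsmul_eq_mul, mul_comm]
      simp only [hterm] at h
      simp only [hexp]
      exact_mod_cast h)
  exact_mod_cast hzero
end

section
/- Let X be an irreducible topological space, f : X → X a continuous map, and a ∈ X a point such that the forward orbit {f^{[k]}(a) : k ∈ ℕ} is dense in X. Then for every positive integer m, the forward orbit of a under the m-fold iterate f^{[m]}, namely {f^{[m·k]}(a) : k ∈ ℕ}, is also dense in X. -/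
/-- In an irreducible space, a dense finite union of sets has a dense member. -/
theorem exists_dense_of_dense_iUnion {X ι : Type*} [TopologicalSpace X] [IrreducibleSpace X]
    [Finite ι] (s : ι → Set X) (hs : Dense (⋃ i, s i)) : ∃ i, Dense (s i) := by
  have hfin : (Set.range fun i => closure (s i)).Finite := Set.finite_range _
  obtain ⟨z, hz, hsub⟩ := isIrreducible_iff_sUnion_isClosed.1
    (IrreducibleSpace.isIrreducible_univ X) hfin.toFinset
    (by
      intro z hz
      obtain ⟨i, rfl⟩ := hfin.mem_toFinset.1 hz
      exact isClosed_closure)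
    (by
      rw [hfin.coe_toFinset, Set.sUnion_range, ← closure_iUnion_of_finite, hs.closure_eq])
  obtain ⟨i, rfl⟩ := hfin.mem_toFinset.1 hz
  exact ⟨i, fun x => hsub (Set.mem_univ x)⟩

/-- Iterates of a continuous self-map with dense range have dense range. -/
theorem DenseRange.iterate {X : Type*} [TopologicalSpace X] {f : X → X}
    (hr : DenseRange f) (hf : Continuous f) (n : ℕ) : DenseRange f^[n] := by
  induction n with
  | zero => exact denseRange_id
  | succ n ih => exact ih.comp hr (hf.iterate n)


/-- If `a` has dense forward orbit under a continuous self-map `f` of an irreducible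
topological space `X`, then for every `m > 0` the forward orbit of `a` under the
`m`-fold iterate `f^[m]` is also dense. -/
theorem iterate_orbit_dense (X : Type*) [TopologicalSpace X] [IrreducibleSpace X]
    (f : X → X) (hf : Continuous f) (a : X)
    (hd : Dense (Set.range fun k : ℕ => f^[k] a)) (m : ℕ) (hm : 0 < m) :
    Dense (Set.range fun k : ℕ => f^[m * k] a) := by
  have hunion : (Set.range fun k : ℕ => f^[k] a) ⊆
      ⋃ i : Fin m, Set.range fun k : ℕ => f^[m * k + i] a := by
    rintro _ ⟨k, rfl⟩
    refine Set.mem_iUnion.2 ⟨⟨k % m, Nat.mod_lt k hm⟩, k / m, ?_⟩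
    simp only [Nat.div_add_mod]
  obtain ⟨⟨i, him⟩, hi⟩ := exists_dense_of_dense_iUnion _ (hd.mono hunion)
  rcases Nat.eq_zero_or_pos i with rfl | hpos
  · exact hi
  have hrange : DenseRange f := hi.mono <| by
    rintro _ ⟨k, rfl⟩
    refine ⟨f^[m * k + (i - 1)] a, ?_⟩
    rw [← Function.iterate_succ_apply' f]
    congr 2
    simp only
    omega
  refine ((hrange.iterate hf (m - i)).dense_image (hf.iterate _) hi).mono ?_
  rintro _ ⟨_, ⟨k, rfl⟩, rfl⟩
  refine ⟨k + 1, ?_⟩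
  simp only [← Function.iterate_add_apply]
  congr 2
  rw [Nat.mul_succ]
  omega
end
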